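/- arXiv:1212.1834 — 6 statements merged into one kernel-verified Lean document; each statement's English description precedes it below -/
import Mathlib

section
/- For every nondegenerate even lattice A of rank n there exist even unimodular lattices U₁ and U₂ and a positive definite even lattice B such that A ⊕ U₁ and B ⊕ U₂ are isomorphic. Precisely: for every symmetric matrix A ∈ Mat_n(ℤ) with even diagonal entries and det A ≠ 0 there exist sizes u₁, u₂, m with n + u₁ = m + u₂, symmetric matrices U₁ ∈ Mat_{u₁}(ℤ) and U₂ ∈ Mat_{u₂}(ℤ) with even diagonal entries and determinant ±1, a positive definite symmetric matrix B ∈ Mat_m(ℤ) with even diagonal entries, and a matrix P ∈ GL_{n+u₁}(ℤ) with Pᵀ·(A ⊕ U₁)·P = B ⊕ U₂. -/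
open Matrix

namespace EvenLattice

/-- An integral Gram matrix is even if it is symmetric with even diagonal. -/
def IsEven {ι : Type} (A : Matrix ι ι ℤ) : Prop :=
  A.IsSymm ∧ ∀ i, Even (A i i)

/-- Integral congruence of Gram matrices indexed by possibly different types. -/
def Congruent {ι κ : Type} [Fintype ι] [DecidableEq ι] [Fintype κ] [DecidableEq κ]
    (A : Matrix ι ι ℤ) (B : Matrix κ κ ℤ) : Prop :=
  ∃ (P : Matrix ι κ ℤ) (Q : Matrix κ ι ℤ), P * Q = 1 ∧ Q * P = 1 ∧ Pᵀ * A * P = B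

/-- The Gram matrix is positive definite on the common kernel of `q` integral functionals. -/
def NegIndexLE {ι : Type} [Fintype ι] (A : Matrix ι ι ℤ) (q : ℕ) : Prop :=
  ∃ φ : (ι → ℤ) →ₗ[ℤ] (Fin q → ℤ), ∀ x, φ x = 0 → x ≠ 0 → 0 < x ⬝ᵥ A *ᵥ x

/-- The Gram matrix of the hyperbolic plane. -/
def hyperbolicPlane : Matrix (Fin 2) (Fin 2) ℤ := !![0, 1; 1, 0]

theorem IsEven.fromBlocks {ι κ : Type} {A : Matrix ι ι ℤ} {B : Matrix κ κ ℤ}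
    (hA : IsEven A) (hB : IsEven B) : IsEven (fromBlocks A 0 0 B) :=
  ⟨hA.1.fromBlocks (by simp) hB.1, by rintro (i | i) <;> simp [hA.2, hB.2]⟩

theorem IsEven.submatrix {ι κ : Type} {A : Matrix ι ι ℤ} (hA : IsEven A) (e : κ → ι) :
    IsEven (A.submatrix e e) :=
  ⟨hA.1.submatrix e, fun _ => hA.2 _⟩

theorem isEven_hyperbolicPlane : IsEven hyperbolicPlane := by
  refine ⟨?_, ?_⟩
  · ext i j
    fin_cases i <;> fin_cases j <;> rfl
  · intro i
    fin_cases i <;> simp [hyperbolicPlane]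

section Congruence

variable {ι κ μ : Type} [Fintype ι] [DecidableEq ι] [Fintype κ] [DecidableEq κ]
  [Fintype μ] [DecidableEq μ]

theorem Congruent.trans {A : Matrix ι ι ℤ} {B : Matrix κ κ ℤ} {C : Matrix μ μ ℤ}
    (h₁ : Congruent A B) (h₂ : Congruent B C) : Congruent A C := by
  obtain ⟨P, Q, hPQ, hQP, rfl⟩ := h₁
  obtain ⟨R, S, hRS, hSR, rfl⟩ := h₂
  refine ⟨P * R, S * Q, ?_, ?_, ?_⟩
  · rw [Matrix.mul_assoc, ← Matrix.mul_assoc R, hRS, Matrix.one_mul, hPQ]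
  · rw [Matrix.mul_assoc, ← Matrix.mul_assoc Q, hQP, Matrix.one_mul, hSR]
  · simp only [Matrix.transpose_mul, Matrix.mul_assoc]

theorem Congruent.submatrix (A : Matrix ι ι ℤ) (e : κ ≃ ι) :
    Congruent A (A.submatrix e e) := by
  refine ⟨(1 : Matrix ι ι ℤ).submatrix id e, (1 : Matrix ι ι ℤ).submatrix e id, ?_, ?_, ?_⟩
  · rw [Matrix.submatrix_mul_equiv]
    simp
  · ext i j
    simp [Matrix.mul_apply, Matrix.one_apply]
  · ext i j
    simp [Matrix.mul_apply, Matrix.one_apply]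

theorem Congruent.symm {A : Matrix ι ι ℤ} {B : Matrix κ κ ℤ}
    (h : Congruent A B) : Congruent B A := by
  obtain ⟨P, Q, hPQ, hQP, rfl⟩ := h
  refine ⟨Q, P, hQP, hPQ, ?_⟩
  have h' : Qᵀ * Pᵀ = 1 := by rw [← Matrix.transpose_mul, hPQ, Matrix.transpose_one]
  calc Qᵀ * (Pᵀ * A * P) * Q = (Qᵀ * Pᵀ) * A * (P * Q) := by simp only [Matrix.mul_assoc]
    _ = A := by rw [h', hPQ, Matrix.one_mul, Matrix.mul_one]

theorem Congruent.add_right {A : Matrix ι ι ℤ} {B : Matrix κ κ ℤ}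
    (h : Congruent A B) (U : Matrix μ μ ℤ) :
    Congruent (fromBlocks A 0 0 U) (fromBlocks B 0 0 U) := by
  obtain ⟨P, Q, hPQ, hQP, rfl⟩ := h
  exact ⟨fromBlocks P 0 0 1, fromBlocks Q 0 0 1,
    by simp [fromBlocks_multiply, hPQ], by simp [fromBlocks_multiply, hQP],
    by simp [fromBlocks_multiply, fromBlocks_transpose]⟩

theorem Congruent.add_assoc (A : Matrix ι ι ℤ) (B : Matrix κ κ ℤ) (C : Matrix μ μ ℤ) :
    Congruent (fromBlocks (fromBlocks A 0 0 B) 0 0 C)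
      (fromBlocks A 0 0 (fromBlocks B 0 0 C)) := by
  convert Congruent.submatrix (fromBlocks (fromBlocks A 0 0 B) 0 0 C)
    (Equiv.sumAssoc ι κ μ).symm using 1
  ext (i | i | i) (j | j | j) <;> simp

theorem Congruent.add_comm (A : Matrix ι ι ℤ) (B : Matrix κ κ ℤ) :
    Congruent (fromBlocks A 0 0 B) (fromBlocks B 0 0 A) := by
  convert Congruent.submatrix (fromBlocks A 0 0 B) (Equiv.sumComm κ ι) using 1
  ext (i | i) (j | j) <;> simp

theorem Congruent.card_eq {A : Matrix ι ι ℤ} {B : Matrix κ κ ℤ}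
    (h : Congruent A B) : Fintype.card ι = Fintype.card κ := by
  obtain ⟨P, Q, hPQ, hQP, -⟩ := h
  simpa using (Matrix.toLin'OfInv hPQ hQP).finrank_eq

theorem Congruent.det_ne_zero {A : Matrix ι ι ℤ} {B : Matrix κ κ ℤ}
    (h : Congruent A B) (hA : A.det ≠ 0) : B.det ≠ 0 := by
  let e : κ ≃ ι := Fintype.equivOfCardEq h.card_eq.symm
  obtain ⟨P, Q, hPQ, hQP, hB⟩ := (Congruent.submatrix A e).symm.trans h
  have hP : P.det ≠ 0 := by
    intro h0
    have := congrArg Matrix.det hPQ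
    simp [h0] at this
  rw [← hB, Matrix.det_mul, Matrix.det_mul, Matrix.det_transpose, Matrix.det_submatrix_equiv_self]
  exact mul_ne_zero (mul_ne_zero hP hA) hP

end Congruence

section Quadratic

variable {ι κ : Type} [Fintype ι] [Fintype κ]

theorem dotProduct_mulVec_comm {A : Matrix ι ι ℤ} (hA : A.IsSymm) (x y : ι → ℤ) :
    x ⬝ᵥ A *ᵥ y = y ⬝ᵥ A *ᵥ x := by
  rw [Matrix.dotProduct_mulVec, ← Matrix.mulVec_transpose, hA.eq, dotProduct_comm]

theorem IsEven.even_dotProduct_mulVec {A : Matrix ι ι ℤ} (hA : IsEven A) (x : ι → ℤ) :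
    Even (x ⬝ᵥ A *ᵥ x) := by
  classical
  rw [← Finset.univ_sum_single x]
  refine Finset.sum_induction _ (fun y => Even (y ⬝ᵥ A *ᵥ y)) ?_ ?_ ?_
  · intro y z hy hz
    rw [Matrix.mulVec_add, add_dotProduct, dotProduct_add, dotProduct_add,
      dotProduct_mulVec_comm hA.1 z y]
    obtain ⟨r, hr⟩ := hy
    obtain ⟨s, hs⟩ := hz
    exact ⟨r + s + y ⬝ᵥ A *ᵥ z, by rw [hr, hs]; ring⟩
  · simp
  · intro i _
    simpa using ((hA.2 i).mul_left (x i)).mul_left (x i)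

theorem sumElim_dotProduct_fromBlocks (A : Matrix ι ι ℤ) (B : Matrix κ κ ℤ)
    (x x' : ι → ℤ) (y y' : κ → ℤ) :
    Sum.elim x y ⬝ᵥ fromBlocks A 0 0 B *ᵥ Sum.elim x' y' = x ⬝ᵥ A *ᵥ x' + y ⬝ᵥ B *ᵥ y' := by
  simp [fromBlocks_mulVec, sumElim_dotProduct_sumElim]

theorem exists_dotProduct_mulVec_neg [DecidableEq ι] {A : Matrix ι ι ℤ} (hA : A.IsSymm)
    (hdet : A.det ≠ 0) {a : ι → ℤ} (ha : a ≠ 0) (haa : a ⬝ᵥ A *ᵥ a ≤ 0) :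
    ∃ b : ι → ℤ, b ⬝ᵥ A *ᵥ b < 0 := by
  rcases haa.lt_or_eq with h | h
  · exact ⟨a, h⟩
  obtain ⟨b, hb⟩ : ∃ b : ι → ℤ, b ⬝ᵥ A *ᵥ a ≠ 0 := by
    by_contra! hcon
    apply ha
    apply Matrix.eq_zero_of_mulVec_eq_zero hdet
    exact dotProduct_eq_zero_iff.mp fun w => by rw [dotProduct_comm]; exact hcon w
  refine ⟨(-((b ⬝ᵥ A *ᵥ a) * (|b ⬝ᵥ A *ᵥ b| + 1))) • a + b, ?_⟩
  simp only [Matrix.mulVec_add, Matrix.mulVec_smul, add_dotProduct, dotProduct_add,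
    smul_dotProduct, dotProduct_smul, smul_eq_mul, dotProduct_mulVec_comm hA a b, h]
  have h1 : 0 < (b ⬝ᵥ A *ᵥ a) ^ 2 := by positivity
  have h2 := le_abs_self (b ⬝ᵥ A *ᵥ b)
  have h3 := abs_nonneg (b ⬝ᵥ A *ᵥ b)
  nlinarith

theorem negIndexLE_card (A : Matrix ι ι ℤ) : NegIndexLE A (Fintype.card ι) := by
  refine ⟨LinearMap.funLeft ℤ ℤ (Fintype.equivFin ι).symm, fun x hx hx0 => (hx0 ?_).elim⟩
  ext i
  simpa using congrFun hx (Fintype.equivFin ι i)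

theorem NegIndexLE.add_right {A : Matrix ι ι ℤ} {q : ℕ} (hA : NegIndexLE A q)
    {E : Matrix κ κ ℤ} (hE : ∀ x, x ≠ 0 → 0 < x ⬝ᵥ E *ᵥ x) :
    NegIndexLE (Matrix.fromBlocks A 0 0 E) q := by
  obtain ⟨φ, hφ⟩ := hA
  refine ⟨φ ∘ₗ LinearMap.funLeft ℤ ℤ Sum.inl, fun x hx hx0 => ?_⟩
  obtain ⟨y, z, rfl⟩ : ∃ y z, x = Sum.elim y z := ⟨_, _, (Sum.elim_comp_inl_inr x).symm⟩
  rw [sumElim_dotProduct_fromBlocks]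
  have hy : φ y = 0 := hx
  have hy' : 0 ≤ y ⬝ᵥ A *ᵥ y := by
    by_cases h : y = 0
    · simp [h]
    · exact (hφ y hy h).le
  by_cases h : z = 0
  · subst h
    have : y ≠ 0 := by
      rintro rfl
      exact hx0 (by ext (i | i) <;> rfl)
    simpa using hφ y hy this
  · have := hE z h
    linarith

theorem NegIndexLE.congr [DecidableEq ι] [DecidableEq κ] {A : Matrix ι ι ℤ} {B : Matrix κ κ ℤ}
    {q : ℕ} (hA : NegIndexLE A q) (h : Congruent A B) : NegIndexLE B q := by
  obtain ⟨φ, hφ⟩ := hA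
  obtain ⟨P, Q, hPQ, hQP, rfl⟩ := h
  refine ⟨φ ∘ₗ P.mulVecLin, fun x hx hx0 => ?_⟩
  have := hφ (P *ᵥ x) hx fun h0 => hx0 <| by
    have := congrArg (Q *ᵥ ·) h0
    simpa [Matrix.mulVec_mulVec, hQP] using this
  convert this using 1
  rw [← Matrix.mulVec_mulVec, ← Matrix.mulVec_mulVec, Matrix.dotProduct_mulVec,
    Matrix.vecMul_transpose]

theorem NegIndexLE.of_hyperbolicPlane_add {B : Matrix κ κ ℤ} {q : ℕ}
    (h : NegIndexLE (Matrix.fromBlocks hyperbolicPlane 0 0 B) (q + 1)) : NegIndexLE B q := by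
  obtain ⟨φ, hφ⟩ := h
  set v : Fin 2 ⊕ κ → ℤ := Sum.elim ![1, 0] 0 with hv
  have hv0 : φ v ≠ 0 := by
    intro h0
    have := hφ v h0 fun h => by simpa [hv] using congrFun h (Sum.inl 0)
    rw [hv, sumElim_dotProduct_fromBlocks] at this
    simp [hyperbolicPlane, Matrix.vecHead] at this
  obtain ⟨i, hi⟩ := Function.ne_iff.mp hv0
  simp only [Pi.zero_apply] at hi
  let incl : (κ → ℤ) →ₗ[ℤ] (Fin 2 ⊕ κ → ℤ) :=
    { toFun := Sum.elim 0
      map_add' := fun x y => by ext (j | j) <;> simp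
      map_smul' := fun c x => by ext (j | j) <;> simp }
  let π : (Fin (q + 1) → ℤ) →ₗ[ℤ] (Fin q → ℤ) :=
    { toFun := fun z j => φ v i * z (i.succAbove j) - z i * φ v (i.succAbove j)
      map_add' := fun x y => by ext j; simp only [Pi.add_apply]; ring
      map_smul' := fun c x => by
        ext j; simp only [Pi.smul_apply, smul_eq_mul, RingHom.id_apply]; ring }
  refine ⟨π ∘ₗ φ ∘ₗ incl, fun y hy hy0 => ?_⟩
  have key : φ (φ v i • incl y - φ (incl y) i • v) = 0 := by
    ext j
    simp only [map_sub, map_smul, Pi.sub_apply, Pi.smul_apply, smul_eq_mul, Pi.zero_apply]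
    rcases Fin.eq_self_or_eq_succAbove i j with rfl | ⟨j, rfl⟩
    · ring
    · exact congrFun hy j
  have hform : φ v i • incl y - φ (incl y) i • v =
      Sum.elim (-(φ (incl y) i) • ![1, 0]) (φ v i • y) := by
    ext (j | j)
    · fin_cases j <;> simp [incl, hv]
    · simp [incl, hv]
  have hpos := hφ _ key fun h0 => hy0 <| by
    rw [hform] at h0
    ext k
    simpa [hi] using congrFun h0 (Sum.inr k)
  rw [hform, sumElim_dotProduct_fromBlocks] at hpos
  simp only [Matrix.mulVec_smul, smul_dotProduct, dotProduct_smul, smul_eq_mul] at hpos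
  have h2 : ![1, 0] ⬝ᵥ hyperbolicPlane *ᵥ ![1, 0] = 0 := by simp [hyperbolicPlane, Matrix.vecHead]
  rw [h2] at hpos
  have h3 : 0 < φ v i ^ 2 := by positivity
  nlinarith

end Quadratic

section Splitting

variable {ι : Type} [Fintype ι] [DecidableEq ι]

/-- A hyperbolic pair spans an orthogonal direct summand. -/
theorem exists_congruent_hyperbolicPlane_add {G : Matrix ι ι ℤ} (hG : IsEven G) {v w : ι → ℤ}
    (hv : v ⬝ᵥ G *ᵥ v = 0) (hw : w ⬝ᵥ G *ᵥ w = 0) (hvw : v ⬝ᵥ G *ᵥ w = 1) :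
    ∃ (m : ℕ) (B : Matrix (Fin m) (Fin m) ℤ), IsEven B ∧
      Congruent G (fromBlocks hyperbolicPlane 0 0 B) := by
  have hwv : w ⬝ᵥ G *ᵥ v = 1 := by rw [dotProduct_mulVec_comm hG.1, hvw]
  let pair (u : ι → ℤ) : (ι → ℤ) →ₗ[ℤ] ℤ := (dotProductBilin ℤ ℤ u) ∘ₗ G.mulVecLin
  have hpair (u x : ι → ℤ) : pair u x = u ⬝ᵥ G *ᵥ x := rfl
  let K : Submodule ℤ (ι → ℤ) := LinearMap.ker (pair v) ⊓ LinearMap.ker (pair w)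
  have hK (x : K) : v ⬝ᵥ G *ᵥ (x : ι → ℤ) = 0 ∧ w ⬝ᵥ G *ᵥ (x : ι → ℤ) = 0 := x.2
  let f : ((Fin 2 → ℤ) × K) →ₗ[ℤ] (ι → ℤ) :=
    LinearMap.coprod (Fintype.linearCombination ℤ ![v, w]) K.subtype
  have hf (c : Fin 2 → ℤ) (x : K) : f (c, x) = c 0 • v + c 1 • w + x := by
    simp [f, Fintype.linearCombination_apply]
  have hbij : Function.Bijective f := by
    constructor
    · rw [← LinearMap.ker_eq_bot, LinearMap.ker_eq_bot']
      rintro ⟨c, x⟩ h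
      rw [hf] at h
      have h0 := congrArg (w ⬝ᵥ G *ᵥ ·) h
      have h1 := congrArg (v ⬝ᵥ G *ᵥ ·) h
      simp only [Matrix.mulVec_add, Matrix.mulVec_smul, dotProduct_add, dotProduct_smul, hv, hw,
        hvw, hwv, hK, Matrix.mulVec_zero, dotProduct_zero, smul_eq_mul, mul_zero, mul_one,
        add_zero, zero_add] at h0 h1
      simp only [h0, h1, zero_smul, zero_add] at h
      ext i
      · fin_cases i <;> simp [h0, h1]
      · simp [h]
    · intro x
      refine ⟨(![w ⬝ᵥ G *ᵥ x, v ⬝ᵥ G *ᵥ x],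
        ⟨x - (w ⬝ᵥ G *ᵥ x) • v - (v ⬝ᵥ G *ᵥ x) • w, ?_, ?_⟩), ?_⟩
      · simp only [LinearMap.mem_ker, SetLike.mem_coe, hpair, Matrix.mulVec_sub, Matrix.mulVec_smul,
          dotProduct_sub, dotProduct_smul, hv, hvw, smul_eq_mul]
        ring
      · simp only [LinearMap.mem_ker, SetLike.mem_coe, hpair, Matrix.mulVec_sub, Matrix.mulVec_smul,
          dotProduct_sub, dotProduct_smul, hw, hwv, smul_eq_mul]
        ring
      · rw [hf]
        simp
  let bK := Module.finBasis ℤ K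
  let b : Module.Basis (Fin 2 ⊕ Fin (Module.finrank ℤ K)) ℤ (ι → ℤ) :=
    ((Pi.basisFun ℤ (Fin 2)).prod bK).map (LinearEquiv.ofBijective f hbij)
  have hb0 : b (Sum.inl 0) = v := by simp [b, hf]
  have hb1 : b (Sum.inl 1) = w := by simp [b, hf]
  have hbK (j) : b (Sum.inr j) = bK j := by simp [b, hf]
  let B : Matrix (Fin (Module.finrank ℤ K)) (Fin (Module.finrank ℤ K)) ℤ :=
    Matrix.of fun j k => (bK j : ι → ℤ) ⬝ᵥ G *ᵥ (bK k : ι → ℤ)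
  refine ⟨_, B, ⟨?_, fun j => hG.even_dotProduct_mulVec _⟩, (Pi.basisFun ℤ ι).toMatrix b,
    b.toMatrix (Pi.basisFun ℤ ι), Module.Basis.toMatrix_mul_toMatrix_flip _ _,
    Module.Basis.toMatrix_mul_toMatrix_flip _ _, ?_⟩
  · ext j k
    exact dotProduct_mulVec_comm hG.1 _ _
  · have hentry (j k) : (((Pi.basisFun ℤ ι).toMatrix b)ᵀ * G * (Pi.basisFun ℤ ι).toMatrix b) j k =
        b j ⬝ᵥ G *ᵥ b k := by
      rw [Matrix.mul_assoc, Matrix.mul_apply']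
      rfl
    have hK' (j) : (bK j : ι → ℤ) ⬝ᵥ G *ᵥ v = 0 ∧ (bK j : ι → ℤ) ⬝ᵥ G *ᵥ w = 0 := by
      rw [dotProduct_mulVec_comm hG.1 _ v, dotProduct_mulVec_comm hG.1 _ w]
      exact hK (bK j)
    ext (j | j) (k | k)
    · rw [hentry]
      fin_cases j <;> fin_cases k <;> simp [hb0, hb1, hyperbolicPlane, hv, hw, hvw, hwv]
    · rw [hentry]
      fin_cases j <;> simp [hb0, hb1, hbK, hK]
    · rw [hentry]
      fin_cases k <;> simp [hb0, hb1, hbK, hK']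
    · rw [hentry, hbK, hbK]
      rfl

end Splitting

section Universal

theorem E₈_dotProduct_mulVec_pos (x : Fin 8 → ℤ) (hx : x ≠ 0) :
    0 < x ⬝ᵥ CartanMatrix.E₈ *ᵥ x := by
  have h : 60 * (x ⬝ᵥ CartanMatrix.E₈ *ᵥ x) =
      30 * (2 * x 0 - x 2) ^ 2 + 30 * (2 * x 1 - x 3) ^ 2 + 10 * (3 * x 2 - 2 * x 3) ^ 2 +
      2 * (5 * x 3 - 6 * x 4) ^ 2 + 3 * (4 * x 4 - 5 * x 5) ^ 2 + 5 * (3 * x 5 - 4 * x 6) ^ 2 +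
      10 * (2 * x 6 - 3 * x 7) ^ 2 + 30 * x 7 ^ 2 := by
    simp [CartanMatrix.E₈, dotProduct, Matrix.mulVec, Fin.sum_univ_eight]
    ring
  by_contra! hle
  have h7 : x 7 = 0 := by rw [← sq_eq_zero_iff]; nlinarith only [h, hle]
  have h6 : 2 * x 6 - 3 * x 7 = 0 := by rw [← sq_eq_zero_iff]; nlinarith only [h, hle]
  have h5 : 3 * x 5 - 4 * x 6 = 0 := by rw [← sq_eq_zero_iff]; nlinarith only [h, hle]
  have h4 : 4 * x 4 - 5 * x 5 = 0 := by rw [← sq_eq_zero_iff]; nlinarith only [h, hle]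
  have h3 : 5 * x 3 - 6 * x 4 = 0 := by rw [← sq_eq_zero_iff]; nlinarith only [h, hle]
  have h2 : 3 * x 2 - 2 * x 3 = 0 := by rw [← sq_eq_zero_iff]; nlinarith only [h, hle]
  have h1 : 2 * x 1 - x 3 = 0 := by rw [← sq_eq_zero_iff]; nlinarith only [h, hle]
  have h0 : 2 * x 0 - x 2 = 0 := by rw [← sq_eq_zero_iff]; nlinarith only [h, hle]
  apply hx
  ext i
  fin_cases i <;> simp <;> lia

/-- The orthogonal sum of five copies of the `E₈` lattice. -/
def fiveE₈ : Matrix (Fin 8 × Fin 5) (Fin 8 × Fin 5) ℤ :=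
  Matrix.blockDiagonal fun _ => CartanMatrix.E₈

theorem fiveE₈_dotProduct_mulVec (x y : Fin 8 × Fin 5 → ℤ) :
    x ⬝ᵥ fiveE₈ *ᵥ y =
      ∑ k, (fun i => x (i, k)) ⬝ᵥ CartanMatrix.E₈ *ᵥ (fun i => y (i, k)) := by
  simp only [fiveE₈, dotProduct, Matrix.mulVec, Matrix.blockDiagonal_apply, Fintype.sum_prod_type]
  rw [Finset.sum_comm]
  simp

theorem isEven_fiveE₈ : IsEven fiveE₈ := by
  refine ⟨?_, fun ⟨i, k⟩ => ?_⟩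
  · rw [Matrix.IsSymm, fiveE₈, Matrix.blockDiagonal_transpose, CartanMatrix.E₈_transpose]
  · simp [fiveE₈, Matrix.blockDiagonal_apply]

theorem det_fiveE₈ : fiveE₈.det = 1 := by
  simp [fiveE₈, Matrix.det_blockDiagonal, CartanMatrix.E₈_det]

theorem fiveE₈_dotProduct_mulVec_pos (x : Fin 8 × Fin 5 → ℤ) (hx : x ≠ 0) :
    0 < x ⬝ᵥ fiveE₈ *ᵥ x := by
  rw [fiveE₈_dotProduct_mulVec]
  have hnonneg (y : Fin 8 → ℤ) : 0 ≤ y ⬝ᵥ CartanMatrix.E₈ *ᵥ y := by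
    by_cases h : y = 0
    · simp [h]
    · exact (E₈_dotProduct_mulVec_pos y h).le
  obtain ⟨⟨i, k⟩, hik⟩ := Function.ne_iff.mp hx
  refine Finset.sum_pos' (fun k _ => hnonneg _) ⟨k, Finset.mem_univ _, ?_⟩
  exact E₈_dotProduct_mulVec_pos _ fun h => hik (congrFun h i)

theorem exists_fiveE₈_vectors {N : ℤ} (hN : 0 < N) :
    ∃ e f : Fin 8 × Fin 5 → ℤ, e ⬝ᵥ fiveE₈ *ᵥ e = 2 * N ∧ f ⬝ᵥ fiveE₈ *ᵥ f = 2 ∧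
      e ⬝ᵥ fiveE₈ *ᵥ f = 1 := by
  obtain ⟨a, b, c, d, h⟩ := Nat.sum_four_squares (N - 1).toNat
  have h' : (a : ℤ) ^ 2 + b ^ 2 + c ^ 2 + d ^ 2 = N - 1 := by
    rw [← Int.toNat_of_nonneg (by lia : 0 ≤ N - 1), ← h]
    push_cast
    rfl
  refine ⟨fun p => Pi.single (M := fun _ => ℤ) 0 (![1, (a : ℤ), b, c, d] p.2) p.1,
    fun p => Pi.single (M := fun _ => ℤ) 2 (![-1, 0, 0, 0, 0] p.2) p.1, ?_, ?_, ?_⟩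
  · rw [fiveE₈_dotProduct_mulVec]
    simp [Fin.sum_univ_five]
    linarith
  · rw [fiveE₈_dotProduct_mulVec]
    simp [Fin.sum_univ_five]
  · rw [fiveE₈_dotProduct_mulVec]
    simp [Fin.sum_univ_five]
    decide

end Universal

section Main

theorem exists_stable_congruence (q : ℕ) :
    ∀ {ι : Type} [Fintype ι] [DecidableEq ι] (A : Matrix ι ι ℤ), IsEven A → A.det ≠ 0 →
      NegIndexLE A q →
      ∃ (α β κ : Type) (_ : Fintype α) (_ : DecidableEq α) (_ : Fintype β) (_ : DecidableEq β)
        (_ : Fintype κ) (_ : DecidableEq κ)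
        (U : Matrix α α ℤ) (V : Matrix β β ℤ) (B : Matrix κ κ ℤ),
        IsEven U ∧ (U.det = 1 ∨ U.det = -1) ∧ IsEven V ∧ (V.det = 1 ∨ V.det = -1) ∧ IsEven B ∧
        B.det ≠ 0 ∧ (∀ x, x ≠ 0 → 0 < x ⬝ᵥ B *ᵥ x) ∧
        Congruent (fromBlocks A 0 0 U) (fromBlocks B 0 0 V) := by
  induction q with
  | zero =>
    intro ι _ _ A hA hdet ⟨φ, hφ⟩
    exact ⟨Fin 2, Fin 2, ι, inferInstance, inferInstance, inferInstance, inferInstance,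
      inferInstance, inferInstance,
      hyperbolicPlane, hyperbolicPlane, A,
      isEven_hyperbolicPlane, by simp [hyperbolicPlane], isEven_hyperbolicPlane,
      by simp [hyperbolicPlane], hA, hdet, fun x => hφ x (Subsingleton.elim _ _),
      Congruent.submatrix _ (Equiv.refl _)⟩
  | succ q ih =>
    intro ι _ _ A hA hdet hq
    by_cases hpos : ∀ x, x ≠ 0 → 0 < x ⬝ᵥ A *ᵥ x
    · exact ih A hA hdet ⟨0, fun x _ => hpos x⟩
    push Not at hpos
    obtain ⟨a₀, ha₀, ha₀'⟩ := hpos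
    obtain ⟨a, ha⟩ := exists_dotProduct_mulVec_neg hA.1 hdet ha₀ ha₀'
    obtain ⟨r, hr⟩ := hA.even_dotProduct_mulVec a
    obtain ⟨e, f, hee, hff, hef⟩ := exists_fiveE₈_vectors (N := -r) (by lia)
    have hG := hA.fromBlocks isEven_fiveE₈
    have hfe : f ⬝ᵥ fiveE₈ *ᵥ e = 1 := by
      rw [dotProduct_mulVec_comm isEven_fiveE₈.1, hef]
    obtain ⟨m, L, hL, hGL⟩ := exists_congruent_hyperbolicPlane_add hG
      (v := Sum.elim a e) (w := Sum.elim (-a) (f - e))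
      (by rw [sumElim_dotProduct_fromBlocks]; lia)
      (by
        rw [sumElim_dotProduct_fromBlocks]
        simp only [Matrix.mulVec_neg, Matrix.mulVec_sub, neg_dotProduct, dotProduct_neg,
          sub_dotProduct, dotProduct_sub]
        lia)
      (by
        rw [sumElim_dotProduct_fromBlocks]
        simp only [Matrix.mulVec_neg, Matrix.mulVec_sub, dotProduct_neg, dotProduct_sub]
        lia)
    have hLdet : L.det ≠ 0 := by
      have := hGL.det_ne_zero (by
        rw [Matrix.det_fromBlocks_zero₂₁, det_fiveE₈]
        simpa using hdet)
      rw [Matrix.det_fromBlocks_zero₂₁] at this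
      exact right_ne_zero_of_mul this
    obtain ⟨α, β, κ, _, _, _, _, _, _, U, V, B, hU, hUdet, hV, hVdet, hB, hBdet, hBpos, hc⟩ :=
      ih L hL hLdet
        ((hq.add_right fiveE₈_dotProduct_mulVec_pos).congr hGL).of_hyperbolicPlane_add
    refine ⟨_, _, κ, inferInstance, inferInstance, inferInstance, inferInstance, inferInstance,
      inferInstance, fromBlocks fiveE₈ 0 0 U, fromBlocks V 0 0 hyperbolicPlane, B,
      isEven_fiveE₈.fromBlocks hU, ?_, hV.fromBlocks isEven_hyperbolicPlane, ?_, hB, hBdet,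
      hBpos, ?_⟩
    · rwa [Matrix.det_fromBlocks_zero₂₁, det_fiveE₈, one_mul]
    · have h2 : hyperbolicPlane.det = -1 := by simp [hyperbolicPlane]
      rw [Matrix.det_fromBlocks_zero₂₁, h2]
      lia
    · exact (Congruent.add_assoc _ _ _).symm.trans <| (hGL.add_right U).trans <|
        (Congruent.add_assoc _ _ _).trans <| (Congruent.add_comm _ _).trans <|
        (hc.add_right hyperbolicPlane).trans (Congruent.add_assoc _ _ _)

theorem posDef_map_intCast {κ : Type} [Fintype κ] [DecidableEq κ] {B : Matrix κ κ ℤ}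
    (hB : B.IsSymm) (hdet : B.det ≠ 0) (hpos : ∀ x, x ≠ 0 → 0 < x ⬝ᵥ B *ᵥ x) :
    (B.map (Int.cast : ℤ → ℝ)).PosDef := by
  have hherm : (B.map (Int.cast : ℤ → ℝ)).IsHermitian := by
    ext i j
    simp [hB.apply i j]
  have hint (x : κ → ℤ) :
      0 ≤ (fun i => (x i : ℝ)) ⬝ᵥ B.map (Int.cast : ℤ → ℝ) *ᵥ (fun i => (x i : ℝ)) := by
    have : 0 ≤ x ⬝ᵥ B *ᵥ x := by
      by_cases h : x = 0
      · simp [h]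
      · exact (hpos x h).le
    simp only [dotProduct, Matrix.mulVec, Matrix.map_apply] at this ⊢
    exact_mod_cast this
  have hrat (x : κ → ℚ) :
      0 ≤ (fun i => (x i : ℝ)) ⬝ᵥ B.map (Int.cast : ℤ → ℝ) *ᵥ (fun i => (x i : ℝ)) := by
    obtain ⟨d, hd⟩ := IsLocalization.exist_integer_multiples_of_finite (nonZeroDivisors ℤ) x
    choose y hy using hd
    have hd0 : ((d : ℤ) : ℝ) ≠ 0 := by exact_mod_cast nonZeroDivisors.ne_zero d.2
    have hxy : (fun i => (y i : ℝ)) = ((d : ℤ) : ℝ) • fun i => (x i : ℝ) := by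
      ext i
      have := hy i
      simp only [algebraMap_int_eq, eq_intCast, zsmul_eq_mul] at this
      simp only [Pi.smul_apply, smul_eq_mul]
      exact_mod_cast this
    have := hint y
    rw [hxy, Matrix.mulVec_smul, smul_dotProduct, dotProduct_smul, smul_smul, smul_eq_mul] at this
    exact nonneg_of_mul_nonneg_right this (mul_self_pos.mpr hd0)
  have hsemi : (B.map (Int.cast : ℤ → ℝ)).PosSemidef := by
    refine Matrix.PosSemidef.of_dotProduct_mulVec_nonneg hherm fun x => ?_
    rw [star_trivial]
    have hdense : DenseRange (Pi.map fun _ : κ => ((↑) : ℚ → ℝ)) :=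
      DenseRange.piMap fun _ => Rat.denseRange_cast
    exact hdense.induction_on (p := fun x => 0 ≤ x ⬝ᵥ B.map (Int.cast : ℤ → ℝ) *ᵥ x) x
      (isClosed_le continuous_const (by fun_prop)) hrat
  rw [hsemi.posDef_iff_isUnit, Matrix.isUnit_iff_isUnit_det, isUnit_iff_ne_zero]
  have hcast := Int.cast_det (R := ℝ) B
  exact hcast ▸ Int.cast_ne_zero.mpr hdet

end Main

end EvenLattice


/-- For every nondegenerate even lattice `A` of rank `n` there exist even
unimodular lattices `U₁, U₂` and a positive definite even lattice `B` with
`A ⊕ U₁ ≅ B ⊕ U₂`: there are sizes `u₁, u₂, m` with `n + u₁ = m + u₂`, and a matrix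
`P ∈ GL_{n+u₁}(ℤ)` with `Pᵀ·(A ⊕ U₁)·P = B ⊕ U₂`. -/
theorem exists_stably_isomorphic_positive_definite_lattice
    (n : ℕ) (A : Matrix (Fin n) (Fin n) ℤ)
    (hSym : A.IsSymm) (hEven : ∀ i, Even (A i i)) (hdet : A.det ≠ 0) :
    ∃ (u₁ u₂ m : ℕ) (U₁ : Matrix (Fin u₁) (Fin u₁) ℤ) (U₂ : Matrix (Fin u₂) (Fin u₂) ℤ)
      (B : Matrix (Fin m) (Fin m) ℤ) (h : n + u₁ = m + u₂),
      U₁.IsSymm ∧ (∀ i, Even (U₁ i i)) ∧ (U₁.det = 1 ∨ U₁.det = -1) ∧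
      U₂.IsSymm ∧ (∀ i, Even (U₂ i i)) ∧ (U₂.det = 1 ∨ U₂.det = -1) ∧
      B.IsSymm ∧ (∀ i, Even (B i i)) ∧ (B.map (Int.cast : ℤ → ℝ)).PosDef ∧
      ∃ P : Matrix (Fin (n + u₁)) (Fin (n + u₁)) ℤ, IsUnit P.det ∧
        Pᵀ * (Matrix.reindex finSumFinEquiv finSumFinEquiv
                (Matrix.fromBlocks A 0 0 U₁)) * P
        = Matrix.reindex (finCongr h.symm) (finCongr h.symm)
            (Matrix.reindex finSumFinEquiv finSumFinEquiv
              (Matrix.fromBlocks B 0 0 U₂)) := by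
  obtain ⟨α, β, κ, _, _, _, _, _, _, U, V, B, hU, hUdet, hV, hVdet, hB, hBdet, hBpos, hc⟩ :=
    EvenLattice.exists_stable_congruence _ A ⟨hSym, hEven⟩ hdet (EvenLattice.negIndexLE_card A)
  let eα := (Fintype.equivFin α).symm
  let eβ := (Fintype.equivFin β).symm
  let eκ := (Fintype.equivFin κ).symm
  have hU' := hU.submatrix eα
  have hV' := hV.submatrix eβ
  have hB' := hB.submatrix eκ
  have h : n + Fintype.card α = Fintype.card κ + Fintype.card β := by
    simpa using hc.card_eq
  refine ⟨_, _, _, U.submatrix eα eα, V.submatrix eβ eβ, B.submatrix eκ eκ, h, hU'.1, hU'.2,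
    by rwa [Matrix.det_submatrix_equiv_self], hV'.1, hV'.2,
    by rwa [Matrix.det_submatrix_equiv_self], hB'.1, hB'.2, ?_, ?_⟩
  · rw [← Matrix.submatrix_map]
    exact (EvenLattice.posDef_map_intCast hB.1 hBdet hBpos).submatrix eκ.injective
  · have hl : EvenLattice.Congruent (fromBlocks A 0 0 U) (Matrix.reindex finSumFinEquiv
        finSumFinEquiv (fromBlocks A 0 0 (U.submatrix eα eα))) := by
      convert EvenLattice.Congruent.submatrix (fromBlocks A 0 0 U)
        (finSumFinEquiv.symm.trans ((Equiv.refl (Fin n)).sumCongr eα)) using 1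
      rw [Matrix.reindex_apply, Equiv.coe_trans, ← Matrix.submatrix_submatrix]
      congr 1
      ext (i | i) (j | j) <;> simp
    have hr : EvenLattice.Congruent (fromBlocks B 0 0 V) (Matrix.reindex (finCongr h.symm)
        (finCongr h.symm) (Matrix.reindex finSumFinEquiv finSumFinEquiv
        (fromBlocks (B.submatrix eκ eκ) 0 0 (V.submatrix eβ eβ)))) := by
      convert EvenLattice.Congruent.submatrix (fromBlocks B 0 0 V)
        ((finCongr h.symm).symm.trans (finSumFinEquiv.symm.trans (eκ.sumCongr eβ))) using 1
      rw [Matrix.reindex_apply, Matrix.reindex_apply, Equiv.coe_trans, Equiv.coe_trans,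
        ← Matrix.submatrix_submatrix, ← Matrix.submatrix_submatrix]
      congr 2
      ext (i | i) (j | j) <;> simp
    obtain ⟨P, Q, hPQ, -, hP⟩ := hl.symm.trans (hc.trans hr)
    exact ⟨P, (Matrix.isUnit_iff_isUnit_det P).mp (IsUnit.of_mul_eq_one Q hPQ), hP⟩
end

section
/- For every positive integer n there exist vectors v, w ∈ ℤ^8 such that vᵀQv = 2n, wᵀQw = 2n, and vᵀQw = 2n − 1, where Q is the Gram matrix of the E8 lattice. -/
open Matrix

/-- The Gram matrix of the `E₈` root lattice (the Cartan matrix of type `E₈`, with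
Bourbaki labelling of the Dynkin diagram: edges 1–3, 3–4, 2–4, 4–5, 5–6, 6–7, 7–8). -/
def E8 : Matrix (Fin 8) (Fin 8) ℤ :=
  !![ 2,  0, -1,  0,  0,  0,  0,  0;
      0,  2,  0, -1,  0,  0,  0,  0;
     -1,  0,  2, -1,  0,  0,  0,  0;
      0, -1, -1,  2, -1,  0,  0,  0;
      0,  0,  0, -1,  2, -1,  0,  0;
      0,  0,  0,  0, -1,  2, -1,  0;
      0,  0,  0,  0,  0, -1,  2, -1;
      0,  0,  0,  0,  0,  0, -1,  2]

/-- For every positive integer `n` there are vectors `v, w ∈ E₈` with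
`vᵀQv = wᵀQw = 2n` and `vᵀQw = 2n − 1`. -/
theorem E8_represents (n : ℕ) (hn : 0 < n) :
    ∃ v w : Fin 8 → ℤ,
      v ⬝ᵥ E8.mulVec v = 2 * n ∧
      w ⬝ᵥ E8.mulVec w = 2 * n ∧
      v ⬝ᵥ E8.mulVec w = 2 * n - 1 := by
  obtain ⟨a, b, c, d, h⟩ := Nat.sum_four_squares (2 * n - 1)
  have hsq : (a : ℤ) ^ 2 + b ^ 2 + c ^ 2 + d ^ 2 = 2 * n - 1 := by
    have hnat : a ^ 2 + b ^ 2 + c ^ 2 + d ^ 2 + 1 = 2 * n := by omega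
    have hcast : (a : ℤ) ^ 2 + b ^ 2 + c ^ 2 + d ^ 2 + 1 = 2 * n := by exact_mod_cast hnat
    linarith
  obtain ⟨m, hm⟩ : Even (1 + a + b + c + d : ℤ) := by
    have hodd : Odd ((a : ℤ) ^ 2 + b ^ 2 + c ^ 2 + d ^ 2) := ⟨n - 1, by rw [hsq]; ring⟩
    have key : Odd (a + b + c + d : ℤ) := by
      simpa [Int.odd_add, Int.even_add, parity_simps] using hodd
    simpa [add_assoc] using odd_one.add_odd key
  have ha : (a : ℤ) = 2 * m - 1 - b - c - d := by linarith
  rw [ha] at hsq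
  -- In the standard coordinates of `E₈`, `v = e₇ + a e₁ + b e₂ + c e₃ + d e₄`
  -- and `v - w` is the root `e₇ - e₆`.
  refine ⟨![0, m, 1 + b + c + d - m, 1 + c + d, 1 + d, 1, 1, 1],
    ![0, m, 1 + b + c + d - m, 1 + c + d, 1 + d, 1, 1, 0], ?_, ?_, ?_⟩ <;>
  · simp [E8, Matrix.mulVec, dotProduct, Fin.sum_univ_succ]
    linarith
end

section
/- Let N ≥ 1, let T ⊂ ℤ^N be a finite set, and let r ∈ T. Then there exists a finite set S ⊂ ℤ^N whose elements generate ℤ^N as a ℤ-module and such that for every s ∈ S and every r' ∈ T, sᵀr' = sᵀr implies r' = r. -/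
open Matrix

/-- If `v` is orthogonal to no element of the finite set `D`, then some translate of `x` by an
integer multiple of `v` is orthogonal to no element of `D` either. -/
theorem exists_add_zsmul_dotProduct_ne_zero {ι : Type*} [Fintype ι] (D : Finset (ι → ℤ))
    {v : ι → ℤ} (hv : ∀ d ∈ D, v ⬝ᵥ d ≠ 0) (x : ι → ℤ) :
    ∃ k : ℤ, ∀ d ∈ D, (x + k • v) ⬝ᵥ d ≠ 0 := by
  obtain ⟨k, hk⟩ := Infinite.exists_notMem_finset (D.image fun d => -(x ⬝ᵥ d) / (v ⬝ᵥ d))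
  refine ⟨k, fun d hd h => hk (Finset.mem_image.2 ⟨d, hd, ?_⟩)⟩
  rw [add_dotProduct, smul_dotProduct, smul_eq_mul] at h
  exact Int.ediv_eq_of_eq_mul_left (hv d hd) (by linarith)

/-- Some integer vector is orthogonal to no element of a given finite set of nonzero vectors. -/
theorem exists_forall_dotProduct_ne_zero {ι : Type*} [Fintype ι] (D : Finset (ι → ℤ))
    (hD : ∀ d ∈ D, d ≠ 0) : ∃ v : ι → ℤ, ∀ d ∈ D, v ⬝ᵥ d ≠ 0 := by
  classical
  induction D using Finset.induction_on with
  | empty => simp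
  | insert d D _ ih =>
    obtain ⟨v, hv⟩ := ih fun e he => hD e (Finset.mem_insert_of_mem he)
    by_cases hvd : v ⬝ᵥ d = 0
    · obtain ⟨k, hk⟩ := exists_add_zsmul_dotProduct_ne_zero D hv d
      refine ⟨d + k • v, fun e he => ?_⟩
      rcases Finset.mem_insert.1 he with rfl | he
      · rw [add_dotProduct, smul_dotProduct, hvd, smul_zero, add_zero]
        exact dotProduct_self_eq_zero.not.2 (hD e (Finset.mem_insert_self e D))
      · exact hk e he
    · exact ⟨v, Finset.forall_mem_insert _ _ _ |>.2 ⟨hvd, hv⟩⟩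

/-- The integer vectors orthogonal to no element of a given finite set of nonzero vectors
generate the whole lattice. -/
theorem span_setOf_forall_dotProduct_ne_zero {ι : Type*} [Fintype ι] (D : Finset (ι → ℤ))
    (hD : ∀ d ∈ D, d ≠ 0) :
    Submodule.span ℤ {s : ι → ℤ | ∀ d ∈ D, s ⬝ᵥ d ≠ 0} = ⊤ := by
  obtain ⟨v, hv⟩ := exists_forall_dotProduct_ne_zero D hD
  refine eq_top_iff.2 fun x _ => ?_
  obtain ⟨k, hk⟩ := exists_add_zsmul_dotProduct_ne_zero D hv x
  rw [← add_sub_cancel_right x (k • v)]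
  exact Submodule.sub_mem _ (Submodule.subset_span hk)
    (Submodule.smul_mem _ k (Submodule.subset_span hv))

/-- Given a finite set `T ⊂ ℤ^N` (`N ≥ 1`) and `r ∈ T`, there is a finite set
`S ⊂ ℤ^N` whose elements generate `ℤ^N` as a `ℤ`-module and such that for all `s ∈ S` and
`r' ∈ T`, `sᵀr' = sᵀr` implies `r' = r`. -/
theorem exists_strong_restriction_set (N : ℕ) (hN : 1 ≤ N) (T : Finset (Fin N → ℤ))
    (r : Fin N → ℤ) (hr : r ∈ T) :
    ∃ S : Finset (Fin N → ℤ),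
      Submodule.span ℤ (S : Set (Fin N → ℤ)) = ⊤ ∧
      ∀ s ∈ S, ∀ r' ∈ T, s ⬝ᵥ r' = s ⬝ᵥ r → r' = r := by
  obtain ⟨S, hS, hspan⟩ := Submodule.fg_span_iff_fg_span_finset_subset (R := ℤ)
    {s : Fin N → ℤ | ∀ d ∈ (T.erase r).image (· - r), s ⬝ᵥ d ≠ 0} |>.1 (IsNoetherian.noetherian _)
  refine ⟨S, ?_, fun s hs r' hr' h => ?_⟩
  · rw [← hspan]
    refine span_setOf_forall_dotProduct_ne_zero _ fun d hd => ?_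
    obtain ⟨r', hr', rfl⟩ := Finset.mem_image.1 hd
    exact sub_ne_zero.2 (Finset.ne_of_mem_erase hr')
  · by_contra hne
    refine hS hs (r' - r) (Finset.mem_image_of_mem _ (Finset.mem_erase.2 ⟨hne, hr'⟩)) ?_
    rw [dotProduct_sub, h, sub_self]
end

section
/- Let N ≥ 2 and let L be a positive definite Jacobi index of rank N. There exists a finite set S of integer N×(N−1) matrices, depending only on L, such that for every τ ∈ ℍ and every holomorphic function f : ℂ^N → ℂ that is elliptic with respect to L and τ, the following holds: if for every s ∈ S the function ℂ^{N−1} → ℂ, z' ↦ f(s·z'), vanishes identically, then f vanishes identically on ℂ^N. -/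
open Matrix Complex

noncomputable section

/-- `e(x) = exp(2πi·x)`. -/
def eC (x : ℂ) : ℂ := Complex.exp (2 * Real.pi * Complex.I * x)

/-- The casting `ℤ^N → ℂ^N`. -/
def zc {N : ℕ} (lam : Fin N → ℤ) : Fin N → ℂ := fun i => (lam i : ℂ)

/-- A function `f : ℂ^N → ℂ` is elliptic with respect to a Jacobi index `L` and `τ` if
`f(z + λτ + μ) = e(−τ·λᵀLλ/2 − λᵀLz)·f(z)` for all `λ, μ ∈ ℤ^N`. -/
def IsElliptic {N : ℕ} (L : Matrix (Fin N) (Fin N) ℤ) (τ : ℂ) (f : (Fin N → ℂ) → ℂ) : Prop :=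
  ∀ lam mu : Fin N → ℤ, ∀ z : Fin N → ℂ,
    f (fun i => z i + (lam i : ℂ) * τ + (mu i : ℂ)) =
      eC (-(τ * (zc lam ⬝ᵥ (L.map (Int.cast : ℤ → ℂ)).mulVec (zc lam)) / 2)
          - zc lam ⬝ᵥ (L.map (Int.cast : ℤ → ℂ)).mulVec z) * f z

/-- `‖e(w)‖ = exp(-2π Im w)`. -/
lemma norm_eC (w : ℂ) : ‖eC w‖ = Real.exp (-(2 * Real.pi * w.im)) := by
  rw [eC, Complex.norm_exp]
  congr 1
  simp

/-- An entire function vanishing on a finite set `Z` is divisible by `∏ z ∈ Z, (X - z)`. -/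
lemma exists_differentiable_eq_prod_mul (Z : Finset ℂ) {G : ℂ → ℂ} (hG : Differentiable ℂ G)
    (hZ : ∀ z ∈ Z, G z = 0) :
    ∃ h : ℂ → ℂ, Differentiable ℂ h ∧ ∀ t, G t = (∏ z ∈ Z, (t - z)) * h t := by
  induction Z using Finset.induction_on with
  | empty => exact ⟨G, hG, by simp⟩
  | insert a Z ha ih =>
    obtain ⟨h, hh, hGh⟩ := ih fun z hz => hZ z (Finset.mem_insert_of_mem hz)
    have hha : h a = 0 := by
      have h0 := hZ a (Finset.mem_insert_self a Z)
      rw [hGh a] at h0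
      refine (mul_eq_zero.1 h0).resolve_left (Finset.prod_ne_zero_iff.2 fun z hz => ?_)
      exact sub_ne_zero.2 fun e => ha (e ▸ hz)
    refine ⟨dslope h a, ?_, fun t => ?_⟩
    · rw [← differentiableOn_univ] at hh ⊢
      exact (Complex.differentiableOn_dslope Filter.univ_mem).2 hh
    · have hs := sub_smul_dslope h a t
      rw [hha, sub_zero, smul_eq_mul] at hs
      rw [Finset.prod_insert ha, hGh t, ← hs]
      ring

/-- A Jensen-type inequality: an entire function bounded by `B` on the circle of radius `3 * ρ`
with many zeros in the disc of radius `ρ` is small at the origin. -/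
lemma norm_zero_mul_two_pow_card_le (Z : Finset ℂ) {G : ℂ → ℂ} (hG : Differentiable ℂ G)
    (hZ : ∀ z ∈ Z, G z = 0) {ρ B : ℝ} (hρ : 0 < ρ) (hZρ : ∀ z ∈ Z, ‖z‖ ≤ ρ)
    (hB : ∀ t, ‖t‖ = 3 * ρ → ‖G t‖ ≤ B) : ‖G 0‖ * 2 ^ Z.card ≤ B := by
  obtain ⟨h, hh, hGh⟩ := exists_differentiable_eq_prod_mul Z hG hZ
  have hpow : 0 < (2 * ρ) ^ Z.card := by positivity
  have hbd : ∀ t ∈ frontier (Metric.ball (0 : ℂ) (3 * ρ)), ‖h t‖ ≤ B / (2 * ρ) ^ Z.card := by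
    intro t ht
    rw [frontier_ball _ (by positivity), mem_sphere_zero_iff_norm] at ht
    rw [le_div_iff₀ hpow, mul_comm]
    refine le_trans ?_ (hB t ht)
    rw [hGh t, norm_mul, norm_prod]
    refine mul_le_mul_of_nonneg_right ?_ (norm_nonneg _)
    rw [← Finset.prod_const]
    refine Finset.prod_le_prod (fun _ _ => by positivity) fun z hz => ?_
    have := norm_sub_norm_le t z
    linarith [hZρ z hz]
  have h0 : ‖h 0‖ ≤ B / (2 * ρ) ^ Z.card :=
    Complex.norm_le_of_forall_mem_frontier_norm_le Metric.isBounded_ball hh.diffContOnCl hbd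
      (subset_closure (Metric.mem_ball_self (by positivity)))
  rw [le_div_iff₀ hpow] at h0
  refine le_trans ?_ h0
  rw [hGh 0, norm_mul, norm_prod, mul_pow, mul_comm _ ‖h 0‖, mul_assoc, mul_comm (2 ^ _)]
  refine mul_le_mul_of_nonneg_left (mul_le_mul_of_nonneg_right ?_ (by positivity)) (norm_nonneg _)
  rw [← Finset.prod_const]
  exact Finset.prod_le_prod (fun _ _ => norm_nonneg _) fun z hz => by simpa using hZρ z hz

/-- The functional equation of a theta function of degree `d` in one variable. -/
def IsTheta (τ : ℂ) (d : ℤ) (c : ℂ) (g : ℂ → ℂ) : Prop :=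
  ∀ l m : ℤ, ∀ t : ℂ,
    g (t + l * τ + m) = eC (-(τ * (l * d * l) / 2) - l * (c + d * t)) * g t

/-- Theta functions have Gaussian growth in the direction of the imaginary axis. -/
lemma IsTheta.exists_norm_le {τ : ℂ} (hτ : 0 < τ.im) {d : ℤ} {c : ℂ} {g : ℂ → ℂ}
    (hθ : IsTheta τ d c g) (hg : Continuous g) :
    ∃ C : ℝ, 0 ≤ C ∧ ∀ (t : ℂ) (M : ℝ), ‖t‖ ≤ M * τ.im →
      ‖g t‖ ≤ C * Real.exp (Real.pi * |(d : ℝ)| * τ.im * (M + 1) ^ 2 + C * (M + 1)) := by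
  obtain ⟨C₀, hC₀⟩ :=
    (isCompact_closedBall (0 : ℂ) (1 + τ.im)).exists_bound_of_continuousOn hg.continuousOn
  have hC₀' : 0 ≤ C₀ := (norm_nonneg _).trans (hC₀ 0 (Metric.mem_closedBall_self (by positivity)))
  set C₁ : ℝ := 2 * Real.pi * (|c.im| + |(d : ℝ)| * τ.im) with hC₁
  have hC₁' : 0 ≤ C₁ := by positivity
  refine ⟨max C₀ C₁, le_max_of_le_left hC₀', fun t M hM => ?_⟩
  set l : ℤ := ⌊t.im / τ.im⌋ with hl
  set m : ℤ := ⌊(t - l * τ).re⌋ with hm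
  set s : ℂ := t - l * τ - m with hs
  have hsre : s.re = Int.fract (t - l * τ).re := by
    rw [Int.fract, ← hm, hs]; simp
  have hsim : s.im = t.im - l * τ.im := by simp [hs]
  have hl1 : l * τ.im ≤ t.im := (le_div_iff₀ hτ).1 (Int.floor_le _)
  have hl2 : t.im < (l + 1) * τ.im := (div_lt_iff₀ hτ).1 (Int.lt_floor_add_one _)
  have hs0 : 0 ≤ s.im := by rw [hsim]; linarith
  have hs1 : s.im ≤ τ.im := by rw [hsim]; linarith
  have hsn : ‖s‖ ≤ 1 + τ.im := by
    refine (Complex.norm_le_abs_re_add_abs_im s).trans ?_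
    rw [abs_of_nonneg hs0, hsre, abs_of_nonneg (Int.fract_nonneg _)]
    linarith [Int.fract_lt_one (t - l * τ).re]
  have hlM : |(l : ℝ)| ≤ M + 1 := by
    have h1 := abs_le.1 ((Complex.abs_im_le_norm t).trans hM)
    rw [abs_le]
    constructor
    · have : (-M) * τ.im < (l + 1) * τ.im := by linarith
      linarith [lt_of_mul_lt_mul_right this hτ.le]
    · have : l * τ.im ≤ M * τ.im := by linarith
      linarith [le_of_mul_le_mul_right this hτ]
  have hts : t = s + l * τ + m := by rw [hs]; ring
  have him : (-(τ * (l * d * l) / 2) - l * (c + d * s) : ℂ).im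
      = -(τ.im * (l * d * l) / 2) - l * (c.im + d * s.im) := by
    have h2 : τ * (l * d * l) / 2 = ((l * d * l / 2 : ℝ) : ℂ) * τ := by push_cast; ring
    have h3 : (l : ℂ) * (c + d * s) = ((l : ℝ) : ℂ) * (c + ((d : ℝ) : ℂ) * s) := by push_cast; ring
    rw [h2, h3, Complex.sub_im, Complex.neg_im, Complex.im_ofReal_mul,
      Complex.im_ofReal_mul, Complex.add_im, Complex.im_ofReal_mul]
    ring
  have hexp : -(2 * Real.pi * (-(τ.im * (l * d * l) / 2) - l * (c.im + d * s.im)))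
      ≤ Real.pi * |(d : ℝ)| * τ.im * (M + 1) ^ 2 + max C₀ C₁ * (M + 1) := by
    have h1 : (l : ℝ) ^ 2 * d ≤ (M + 1) ^ 2 * |(d : ℝ)| := by
      refine (mul_le_mul_of_nonneg_left (le_abs_self _) (sq_nonneg _)).trans
        (mul_le_mul_of_nonneg_right ?_ (abs_nonneg _))
      rw [← sq_abs (l : ℝ)]
      gcongr
    have h2 : (l : ℝ) * (c.im + d * s.im) ≤ (M + 1) * (|c.im| + |(d : ℝ)| * τ.im) := by
      refine (le_abs_self _).trans ?_
      rw [abs_mul]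
      refine mul_le_mul hlM ((abs_add_le _ _).trans ?_) (abs_nonneg _) ((abs_nonneg _).trans hlM)
      rw [abs_mul, abs_of_nonneg hs0]
      gcongr
    have h3 : C₁ * (M + 1) ≤ max C₀ C₁ * (M + 1) :=
      mul_le_mul_of_nonneg_right (le_max_right _ _) ((abs_nonneg _).trans hlM)
    have h4 := mul_le_mul_of_nonneg_left h1 (show 0 ≤ Real.pi * τ.im by positivity)
    have h5 := mul_le_mul_of_nonneg_left h2 (show 0 ≤ 2 * Real.pi by positivity)
    rw [hC₁] at h3
    linarith
  rw [hts, hθ, norm_mul, norm_eC, him, mul_comm]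
  refine mul_le_mul ((hC₀ s (by simpa using hsn)).trans (le_max_left _ _))
    (Real.exp_le_exp.2 hexp) (Real.exp_pos _).le (le_max_of_le_left hC₀')

lemma exists_nat_linear_lt_quadratic {a : ℝ} (ha : 0 < a) (b c : ℝ) :
    ∃ n : ℕ, b * n + c < a * (n : ℝ) ^ 2 := by
  obtain ⟨n, hn⟩ := exists_nat_gt ((|b| + |c|) / a + 1)
  refine ⟨n, ?_⟩
  have h0 : 0 ≤ (|b| + |c|) / a := by positivity
  have hn1 : 1 ≤ (n : ℝ) := by linarith
  have h1 : |b| + |c| < a * n := by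
    rw [← div_lt_iff₀' ha]; linarith
  have h2 : b * n ≤ |b| * n := mul_le_mul_of_nonneg_right (le_abs_self b) (by linarith)
  have h3 : |c| * 1 ≤ |c| * n := mul_le_mul_of_nonneg_left hn1 (abs_nonneg c)
  have h4 := mul_lt_mul_of_pos_right h1 (show (0 : ℝ) < n by linarith)
  nlinarith [le_abs_self c]

lemma IsTheta.eq_zero_of_apply_eq_zero {τ : ℂ} {d : ℤ} {c : ℂ} {g : ℂ → ℂ}
    (hθ : IsTheta τ d c g) {t : ℂ} (ht : g t = 0) (l m : ℤ) : g (t + l * τ + m) = 0 := by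
  rw [hθ, ht, mul_zero]

lemma IsTheta.comp_add {τ : ℂ} {d : ℤ} {c : ℂ} {g : ℂ → ℂ} (hθ : IsTheta τ d c g) (t₀ : ℂ) :
    IsTheta τ d (c + d * t₀) fun t => g (t + t₀) := by
  intro l m t
  have h := hθ l m (t + t₀)
  dsimp only
  rw [show t + l * τ + m + t₀ = t + t₀ + l * τ + m by ring, h]
  congr 2
  ring

/-- Two points of `ℂ` that agree modulo `ℤτ + ℤ` do so in a unique way. -/
lemma int_mul_add_int_inj {τ : ℂ} (hτ : 0 < τ.im) {l m l' m' : ℤ}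
    (h : (l : ℂ) * τ + m = l' * τ + m') : l = l' ∧ m = m' := by
  have hl : l = l' := by
    have := congrArg Complex.im h
    simp only [Complex.add_im, Complex.mul_im, Complex.intCast_re, Complex.intCast_im, zero_mul,
      add_zero] at this
    exact_mod_cast mul_right_cancel₀ hτ.ne' this
  subst hl
  exact ⟨rfl, by exact_mod_cast add_left_cancel h⟩

/-- A theta function of degree `d` with too many zeros modulo the lattice vanishes at `0`. The
bound on the number of zeros is not sharp. -/
lemma IsTheta.apply_zero_eq_zero {τ : ℂ} (hτ : 0 < τ.im) {d : ℤ} {c : ℂ} {g : ℂ → ℂ}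
    (hθ : IsTheta τ d c g) (hg : Differentiable ℂ g) {K : ℕ}
    (hK : 200 * (|(d : ℝ)| + 1) ≤ K) (x : Fin K → ℂ) (hx : ∀ i, g (x i) = 0)
    (hinj : ∀ i j, ∀ l m : ℤ, x i - x j = l * τ + m → i = j) : g 0 = 0 := by
  by_contra hg0
  obtain ⟨C, hC, hgrowth⟩ := hθ.exists_norm_le hτ hg.continuous
  set v := τ.im with hv
  set D : ℝ := |(d : ℝ)| with hD
  have hD0 : 0 ≤ D := abs_nonneg _
  set X : ℝ := ∑ i, ‖x i‖ with hX
  have hX0 : 0 ≤ X := Finset.sum_nonneg fun _ _ => norm_nonneg _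
  have hxX : ∀ i, ‖x i‖ ≤ X := fun i =>
    Finset.single_le_sum (f := fun i => ‖x i‖) (fun _ _ => norm_nonneg _) (Finset.mem_univ i)
  set E : ℝ := (3 * X + 6) / v + 1 with hE
  have key : ∀ n : ℕ, Real.log ‖g 0‖ + K * (n * (n * v)) * Real.log 2
      ≤ Real.log (C + 1) + (Real.pi * D * v * (6 * n + E) ^ 2 + C * (6 * n + E)) := by
    intro n
    set ρ : ℝ := X + 2 * (n * v) + 2 with hρ
    have hnv : 0 ≤ n * v := by positivity
    let p : Fin K × Fin n × Fin ⌈n * v⌉₊ → ℂ := fun q =>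
      x q.1 + ((q.2.1 : ℕ) : ℤ) * τ + (((q.2.2 : ℕ) : ℤ) - ⌊((q.2.1 : ℕ) : ℝ) * τ.re⌋ : ℤ)
    have hp : Function.Injective p := by
      rintro ⟨i, l, k⟩ ⟨i', l', k'⟩ h
      simp only [p] at h
      have hi : i = i' := by
        refine hinj i i' ((l' : ℕ) - (l : ℕ) : ℤ)
          (((k' : ℕ) - ⌊((l' : ℕ) : ℝ) * τ.re⌋) - ((k : ℕ) - ⌊((l : ℕ) : ℝ) * τ.re⌋) : ℤ) ?_
        push_cast at h ⊢
        linear_combination h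
      subst hi
      rw [add_assoc, add_assoc] at h
      obtain ⟨h1, h2⟩ := int_mul_add_int_inj hτ (add_left_cancel h)
      have hl : l = l' := Fin.ext (by exact_mod_cast h1)
      subst hl
      have hk : k = k' := Fin.ext (by omega)
      rw [hk]
    have hpn : ∀ q, ‖p q‖ ≤ ρ := by
      rintro ⟨i, l, k⟩
      have hl : ((l : ℕ) : ℝ) * v ≤ n * v :=
        mul_le_mul_of_nonneg_right (by exact_mod_cast l.2.le) hτ.le
      have hl0 : 0 ≤ ((l : ℕ) : ℝ) * v := by positivity
      have hk : ((k : ℕ) : ℝ) ≤ n * v := (Nat.lt_ceil.1 k.2).le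
      have hk0 : 0 ≤ ((k : ℕ) : ℝ) := by positivity
      have hf0 := Int.fract_nonneg (((l : ℕ) : ℝ) * τ.re)
      have hf1 := (Int.fract_lt_one (((l : ℕ) : ℝ) * τ.re)).le
      rw [Int.fract] at hf0 hf1
      simp only [p]
      rw [add_assoc]
      refine (norm_add_le _ _).trans ?_
      have := Complex.norm_le_abs_re_add_abs_im
        ((((l : ℕ) : ℤ) : ℂ) * τ + ((((k : ℕ) : ℤ) - ⌊((l : ℕ) : ℝ) * τ.re⌋ : ℤ) : ℂ))
      simp only [Complex.add_re, Complex.mul_re, Complex.add_im, Complex.mul_im,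
        Complex.intCast_re, Complex.intCast_im, zero_mul, sub_zero, add_zero, Int.cast_sub,
        Int.cast_natCast, Complex.sub_re, Complex.sub_im, Complex.natCast_re,
        Complex.natCast_im] at this
      rw [← hv, abs_of_nonneg hl0, abs_of_nonneg (by linarith)] at this
      push_cast at this ⊢
      linarith [hxX i]
    have hcard : (Finset.univ.map ⟨p, hp⟩).card = K * (n * ⌈n * v⌉₊) := by simp
    have hE' : 3 * ρ = (6 * n + E - 1) * v := by
      rw [hρ, hE]; field_simp; ring
    have hmain := norm_zero_mul_two_pow_card_le (Finset.univ.map ⟨p, hp⟩) hg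
      (ρ := ρ) (B := C * Real.exp (Real.pi * D * v * (6 * n + E) ^ 2 + C * (6 * n + E)))
      (by
        intro z hz
        obtain ⟨q, -, rfl⟩ := Finset.mem_map.1 hz
        exact hθ.eq_zero_of_apply_eq_zero (hx _) _ _)
      (by positivity)
      (by
        intro z hz
        obtain ⟨q, -, rfl⟩ := Finset.mem_map.1 hz
        exact hpn q)
      (by
        intro t ht
        have := hgrowth t (6 * n + E - 1) (by rw [ht, hE'])
        rwa [sub_add_cancel] at this)
    have hg0' : 0 < ‖g 0‖ := norm_pos_iff.2 hg0
    have hmain' : ‖g 0‖ * 2 ^ (K * (n * ⌈n * v⌉₊))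
        ≤ (C + 1) * Real.exp (Real.pi * D * v * (6 * n + E) ^ 2 + C * (6 * n + E)) := by
      rw [hcard] at hmain
      exact hmain.trans (mul_le_mul_of_nonneg_right (by linarith) (Real.exp_pos _).le)
    have hlog := Real.log_le_log (by positivity) hmain'
    rw [Real.log_mul hg0'.ne' (by positivity), Real.log_pow,
      Real.log_mul (by positivity) (Real.exp_pos _).ne', Real.log_exp] at hlog
    refine le_trans ?_ hlog
    have hlog2 : 0 ≤ Real.log 2 := Real.log_nonneg (by norm_num)
    push_cast
    have := Nat.le_ceil (n * v)
    gcongr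
  obtain ⟨n, hn⟩ := exists_nat_linear_lt_quadratic (show 0 < 20 * (D + 1) * v by positivity)
    (12 * Real.pi * D * v * E + 6 * C)
    (Real.log (C + 1) + Real.pi * D * v * E ^ 2 + C * E - Real.log ‖g 0‖)
  have hkn := key n
  have h1 : 200 * (D + 1) * (n * (n * v)) * 0.69 ≤ K * (n * (n * v)) * Real.log 2 := by
    have := Real.log_two_gt_d9
    have : (0.69 : ℝ) ≤ Real.log 2 := by linarith
    gcongr
  have h2 : Real.pi * (D * v * n ^ 2) ≤ 3.15 * (D * v * n ^ 2) :=
    mul_le_mul_of_nonneg_right Real.pi_lt_d2.le (by positivity)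
  have h3 : 0 ≤ v * (n : ℝ) ^ 2 := by positivity
  have h4 : 0 ≤ D * v * (n : ℝ) ^ 2 := by positivity
  nlinarith

/-- A theta function of degree `d` with too many zeros modulo the lattice vanishes. -/
lemma IsTheta.eq_zero {τ : ℂ} (hτ : 0 < τ.im) {d : ℤ} {c : ℂ} {g : ℂ → ℂ}
    (hθ : IsTheta τ d c g) (hg : Differentiable ℂ g) {K : ℕ}
    (hK : 200 * (|(d : ℝ)| + 1) ≤ K) (x : Fin K → ℂ) (hx : ∀ i, g (x i) = 0)
    (hinj : ∀ i j, ∀ l m : ℤ, x i - x j = l * τ + m → i = j) (t : ℂ) : g t = 0 := by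
  have := (hθ.comp_add t).apply_zero_eq_zero hτ (hg.comp (differentiable_id.add_const t)) hK
    (fun i => x i - t) (by simpa using hx) (by simpa using hinj)
  simpa using this

/-- Restricting an elliptic function to a line parallel to the first coordinate axis yields a
theta function. -/
lemma IsElliptic.isTheta_cons {M : ℕ} {L : Matrix (Fin (M + 1)) (Fin (M + 1)) ℤ} {τ : ℂ}
    {f : (Fin (M + 1) → ℂ) → ℂ} (hf : IsElliptic L τ f) (a : Fin M → ℂ) :
    IsTheta τ (L 0 0) (∑ i : Fin M, (L 0 i.succ : ℂ) * a i) fun t => f (Fin.cons t a) := by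
  intro l m t
  have h := hf (Pi.single 0 l) (Pi.single 0 m) (Fin.cons t a)
  have hz : zc (Pi.single (0 : Fin (M + 1)) l) = Pi.single 0 (l : ℂ) := by
    ext i
    rcases eq_or_ne i 0 with rfl | hi <;> simp [zc, *]
  have harg : (fun i => (Fin.cons t a : Fin (M + 1) → ℂ) i
      + ((Pi.single 0 l : Fin (M + 1) → ℤ) i : ℂ) * τ + ((Pi.single 0 m : Fin (M + 1) → ℤ) i : ℂ))
      = Fin.cons (t + l * τ + m) a := by
    ext i
    refine Fin.cases ?_ (fun i => ?_) i <;> simp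
  rw [harg, hz] at h
  simp only [h]
  congr 2
  simp [Matrix.mulVec, dotProduct, Fin.sum_univ_succ]
  ring

/-- The matrix parametrizing the hyperplane `z₀ = j z₁`. -/
def hyperplaneMatrix (M : ℕ) (j : ℤ) : Matrix (Fin (M + 2)) (Fin (M + 1)) ℤ :=
  Matrix.of (Fin.cons (Pi.single 0 j) fun i => Pi.single i 1)

lemma hyperplaneMatrix_mulVec (M : ℕ) (j : ℤ) (a : Fin (M + 1) → ℂ) :
    ((hyperplaneMatrix M j).map (Int.cast : ℤ → ℂ)).mulVec a = Fin.cons (j * a 0) a := by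
  ext i
  refine Fin.cases ?_ (fun i => ?_) i <;>
    simp [hyperplaneMatrix, Matrix.mulVec, dotProduct, Pi.single_apply]

/-- An elliptic function vanishing on sufficiently many hyperplanes `z₀ = j z₁` vanishes. -/
lemma IsElliptic.eq_zero_of_hyperplanes {M : ℕ} {L : Matrix (Fin (M + 2)) (Fin (M + 2)) ℤ} {τ : ℂ}
    (hτ : 0 < τ.im) {f : (Fin (M + 2) → ℂ) → ℂ} (hd : Differentiable ℂ f) (hf : IsElliptic L τ f)
    {K : ℕ} (hK : 200 * (|(L 0 0 : ℝ)| + 1) ≤ K)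
    (hv : ∀ j < K, ∀ a : Fin (M + 1) → ℂ, f (Fin.cons (j * a 0) a) = 0) (z : Fin (M + 2) → ℂ) :
    f z = 0 := by
  set bad : Set ℂ := Set.range fun q : ℤ × ℤ × ℤ => ((q.1 : ℂ) * τ + q.2.1) / q.2.2 with hbad
  have hdense : Dense badᶜ := (Set.countable_range _).dense_compl ℂ
  have hgood : ∀ a : Fin (M + 1) → ℂ, a 0 ∉ bad → ∀ t, f (Fin.cons t a) = 0 := by
    intro a ha
    refine (hf.isTheta_cons a).eq_zero hτ (hd.comp ?_) hK (fun j : Fin K => (j : ℕ) * a 0)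
      (fun j => hv j j.2 a) fun i j l m h => ?_
    · rw [differentiable_pi]
      intro i
      refine Fin.cases ?_ (fun i => ?_) i <;> simp
    · by_contra hij
      refine ha ⟨(l, m, (i : ℕ) - (j : ℕ)), ?_⟩
      have hne : (((i : ℕ) : ℂ) - ((j : ℕ) : ℂ)) ≠ 0 :=
        sub_ne_zero.2 fun e => hij (Fin.ext (by exact_mod_cast e))
      push_cast
      rw [← h, ← sub_mul, mul_div_cancel_left₀ _ hne]
  let F : ℂ → ℂ := fun w => f (Function.update z 1 w)
  have hF : F = fun _ => 0 := by
    refine Continuous.ext_on hdense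
      (hd.continuous.comp (continuous_const.update 1 continuous_id)) continuous_const ?_
    intro w hw
    have := hgood (Fin.tail (Function.update z 1 w)) (by simpa [Fin.tail] using hw)
      (Function.update z 1 w 0)
    rwa [Fin.cons_self_tail] at this
  simpa [F] using congrFun hF (z 1)

/-- For a positive definite Jacobi index `L` of rank `N ≥ 2` there is a
finite set `S` of integer `N×(N−1)` matrices, depending only on `L`, such that any
holomorphic function elliptic with respect to `L` and some `τ ∈ ℍ` vanishing along all
restrictions `z' ↦ f(s·z')`, `s ∈ S`, vanishes identically. -/
theorem elliptic_vanishing_by_matrix_restrictions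
    (N : ℕ) (hN : 2 ≤ N) (L : Matrix (Fin N) (Fin N) ℤ)
    (hSym : L.IsSymm) (hEven : ∀ i, Even (L i i))
    (hPos : (L.map (Int.cast : ℤ → ℝ)).PosDef) :
    ∃ S : Finset (Matrix (Fin N) (Fin (N - 1)) ℤ),
      ∀ τ : UpperHalfPlane, ∀ f : (Fin N → ℂ) → ℂ,
        Differentiable ℂ f → IsElliptic L (τ : ℂ) f →
        (∀ s ∈ S, ∀ z' : Fin (N - 1) → ℂ,
          f ((s.map (Int.cast : ℤ → ℂ)).mulVec z') = 0) →
        ∀ z : Fin N → ℂ, f z = 0 := by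
  obtain ⟨M, rfl⟩ := Nat.exists_eq_add_of_le' hN
  obtain ⟨K, hK⟩ := exists_nat_ge (200 * (|(L 0 0 : ℝ)| + 1))
  refine ⟨(Finset.range K).image fun j : ℕ => hyperplaneMatrix M j, fun τ f hd hf hv z => ?_⟩
  refine hf.eq_zero_of_hyperplanes τ.im_pos hd hK (fun j hj a => ?_) z
  have h := hv _ (Finset.mem_image_of_mem _ (Finset.mem_range.2 hj)) a
  rw [hyperplaneMatrix_mulVec] at h
  exact_mod_cast h
end
end

section
/- Let L be a positive definite Jacobi index of rank N and let s̃ ∈ Mat_N(ℤ) with det s̃ ≠ 0 be such that L = s̃ᵀL's̃ for some symmetric matrix L' ∈ Mat_N(ℤ) with even diagonal entries. Then there exists a finite set S of nonzero vectors in ℤ^N, depending only on L and s̃, with the following property. Let k ∈ ℤ and let c be a formal Jacobi Fourier coefficient system of weight k and index L. For s ∈ S let l_s denote the greatest common divisor of the entries of s̃·s. Suppose that for every s ∈ S, every n ∈ ℤ, and every integer r̃ not divisible by l_s, the sum Σ_{r ∈ ℤ^N, sᵀr = r̃} c(n, r) vanishes (this sum has only finitely many nonzero terms by condition (iii)). Then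 c(n, r) = 0 for every pair (n, r) ∈ ℤ × ℤ^N such that r does not lie in s̃ᵀℤ^N. -/
open Matrix

/-- The quadratic form of an even symmetric integral matrix takes even values. -/
lemma exists_two_mul_eq_dotProduct_mulVec {N : ℕ} {L : Matrix (Fin N) (Fin N) ℤ}
    (hSym : L.IsSymm) (hEven : ∀ i, Even (L i i)) (x : Fin N → ℤ) :
    ∃ m : ℤ, 2 * m = x ⬝ᵥ L.mulVec x := by
  let U : Matrix (Fin N) (Fin N) ℤ := Matrix.of fun i j =>
    if i < j then L i j else if i = j then L i i / 2 else 0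
  have hU : L = U + Uᵀ := by
    ext i j
    simp only [U, Matrix.add_apply, Matrix.transpose_apply, Matrix.of_apply]
    rcases lt_trichotomy i j with h | h | h
    · simp [h, h.not_gt, h.ne']
    · subst h
      obtain ⟨a, ha⟩ := hEven i
      simp only [lt_irrefl, if_false, if_true]
      omega
    · simp [h, h.not_gt, h.ne', hSym.apply j i]
  refine ⟨x ⬝ᵥ U.mulVec x, ?_⟩
  have hT : x ⬝ᵥ Uᵀ.mulVec x = x ⬝ᵥ U.mulVec x := by
    rw [Matrix.mulVec_transpose, dotProduct_comm, ← Matrix.dotProduct_mulVec]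
  rw [hU, Matrix.add_mulVec, dotProduct_add, hT, two_mul]

/-- Finitely many nonconstant integral affine forms have a common integral point at which none of
them vanishes. -/
lemma exists_forall_apply_add_mul_dotProduct_ne_zero {N : ℕ} {d : ℤ} (hd : d ≠ 0) (i : Fin N)
    (Y : Finset (Fin N → ℤ)) (hY : ∀ y ∈ Y, y ≠ 0) :
    ∃ t : Fin N → ℤ, ∀ y ∈ Y, y i + d * (t ⬝ᵥ y) ≠ 0 := by
  let p : (Fin N → ℤ) → MvPolynomial (Fin N) ℤ := fun y =>
    MvPolynomial.C (y i) + MvPolynomial.C d * ∑ j, MvPolynomial.X j * MvPolynomial.C (y j)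
  have hp : ∀ t y, MvPolynomial.eval t (p y) = y i + d * (t ⬝ᵥ y) := by
    intro t y
    simp [p, dotProduct]
  have hne : ∏ y ∈ Y, p y ≠ 0 := by
    refine Finset.prod_ne_zero_iff.2 fun y hy h0 => ?_
    have hev : ∀ t : Fin N → ℤ, y i + d * (t ⬝ᵥ y) = 0 := by
      intro t
      rw [← hp, h0, map_zero]
    have hi : y i = 0 := by simpa using hev 0
    apply hY y hy
    ext j
    simpa [hi, hd] using hev (Pi.single j 1)
  obtain ⟨t, ht⟩ : ∃ t, MvPolynomial.eval t (∏ y ∈ Y, p y) ≠ 0 := by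
    by_contra! h
    exact hne (MvPolynomial.funext fun t => by simpa using h t)
  rw [map_prod, Finset.prod_ne_zero_iff] at ht
  exact ⟨t, fun y hy => hp t y ▸ ht y hy⟩

/-- If `r₀` is not in the lattice `Aᵀℤ^N`, then some `s` detects this through the greatest common
divisor of the entries of `A s` and separates `r₀` from any given finite set. -/
lemma exists_separating_vector {N : ℕ} {A : Matrix (Fin N) (Fin N) ℤ} (hA : A.det ≠ 0)
    {r₀ : Fin N → ℤ} (hr₀ : ¬ ∃ y : Fin N → ℤ, r₀ = Aᵀ.mulVec y) (F : Finset (Fin N → ℤ)) :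
    ∃ s : Fin N → ℤ, (¬ (Finset.univ.gcd fun i => A.mulVec s i) ∣ s ⬝ᵥ r₀) ∧
      ∀ r ∈ F, r ≠ r₀ → s ⬝ᵥ r ≠ s ⬝ᵥ r₀ := by
  have hAB : ∀ x, Aᵀ.mulVec (A.adjugateᵀ.mulVec x) = A.det • x := by
    intro x
    rw [Matrix.mulVec_mulVec, ← Matrix.transpose_mul, Matrix.adjugate_mul,
      Matrix.transpose_smul, Matrix.transpose_one, Matrix.smul_mulVec, Matrix.one_mulVec]
  obtain ⟨i, hi⟩ : ∃ i, ¬ A.det ∣ A.adjugateᵀ.mulVec r₀ i := by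
    by_contra! h
    choose y hy using h
    refine hr₀ ⟨y, smul_right_injective _ hA ?_⟩
    have hy' : A.adjugateᵀ.mulVec r₀ = A.det • y := by
      ext j
      simpa using hy j
    simp only
    rw [← hAB, hy', Matrix.mulVec_smul]
  classical
  obtain ⟨t, ht⟩ := exists_forall_apply_add_mul_dotProduct_ne_zero hA i
    ((F.erase r₀).image fun r => A.adjugateᵀ.mulVec (r - r₀)) (by
      intro y hy h0
      obtain ⟨r, hr, rfl⟩ := Finset.mem_image.1 hy
      have h := hAB (r - r₀)
      rw [h0, Matrix.mulVec_zero, eq_comm, smul_eq_zero] at h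
      exact Finset.ne_of_mem_erase hr (sub_eq_zero.1 (h.resolve_left hA)))
  have hs : ∀ x, A.adjugate.mulVec (Pi.single i 1 + A.det • t) ⬝ᵥ x =
      A.adjugateᵀ.mulVec x i + A.det * (t ⬝ᵥ A.adjugateᵀ.mulVec x) := by
    intro x
    rw [dotProduct_comm, Matrix.dotProduct_mulVec, ← Matrix.mulVec_transpose, dotProduct_comm,
      add_dotProduct, smul_dotProduct, single_one_dotProduct, smul_eq_mul]
  refine ⟨A.adjugate.mulVec (Pi.single i 1 + A.det • t), fun h => hi ?_, fun r hr hne h => ?_⟩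
  · have hdvd : A.det ∣ A.adjugate.mulVec (Pi.single i 1 + A.det • t) ⬝ᵥ r₀ := by
      refine (Finset.dvd_gcd fun j _ => ?_).trans h
      rw [Matrix.mulVec_mulVec, Matrix.mul_adjugate, Matrix.smul_mulVec, Matrix.one_mulVec]
      exact Dvd.intro _ rfl
    rw [hs] at hdvd
    exact (dvd_add_left (dvd_mul_right _ _)).1 hdvd
  · refine ht _ (Finset.mem_image.2 ⟨r, Finset.mem_erase.2 ⟨hne, hr⟩, rfl⟩) ?_
    rw [← hs, dotProduct_sub, h, sub_self]

/-- An integral matrix which is positive definite over `ℝ` is positive on nonzero integral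
vectors. -/
lemma dotProduct_mulVec_pos_of_posDef_map {N : ℕ} {L : Matrix (Fin N) (Fin N) ℤ}
    (hPos : (L.map (Int.cast : ℤ → ℝ)).PosDef) {x : Fin N → ℤ} (hx : x ≠ 0) :
    0 < x ⬝ᵥ L.mulVec x := by
  have hx' : (fun i => (x i : ℝ)) ≠ 0 := fun h => hx (by
    ext i
    simpa using congrFun h i)
  have h := hPos.dotProduct_mulVec_pos hx'
  have e : star (fun i => (x i : ℝ)) ⬝ᵥ (L.map (Int.cast : ℤ → ℝ)).mulVec (fun i => (x i : ℝ)) =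
      ((x ⬝ᵥ L.mulVec x : ℤ) : ℝ) := by
    simp [dotProduct, Matrix.mulVec]
  rw [e] at h
  exact_mod_cast h

/-- Sublevel sets of the dual quadratic form of a positive definite integral matrix are finite. -/
lemma finite_setOf_dotProduct_adjugate_mulVec_le {N : ℕ} {L : Matrix (Fin N) (Fin N) ℤ}
    (hSym : L.IsSymm) (hPos : (L.map (Int.cast : ℤ → ℝ)).PosDef) (hdet : 0 < L.det) (C : ℤ) :
    {r : Fin N → ℤ | r ⬝ᵥ L.adjugate.mulVec r ≤ C}.Finite := by
  refine (Set.finite_Icc (fun i => -(L i i * C)) (fun i => L i i * C)).subset fun r hr => ?_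
  rw [Set.mem_ofPred_eq] at hr
  have hbound : ∀ i, r i ^ 2 ≤ L i i * C := by
    intro i
    set y := L.adjugate.mulVec r with hy
    have hLy : L.mulVec y = L.det • r := by
      rw [hy, Matrix.mulVec_mulVec, Matrix.mul_adjugate, Matrix.smul_mulVec, Matrix.one_mulVec]
    have hLi : 0 < L i i := by
      have h := dotProduct_mulVec_pos_of_posDef_map hPos (x := Pi.single i 1) (by simp)
      simpa using h
    have hnn : ∀ x : Fin N → ℤ, 0 ≤ x ⬝ᵥ L.mulVec x := by
      intro x
      rcases eq_or_ne x 0 with rfl | hx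
      · simp
      · exact (dotProduct_mulVec_pos_of_posDef_map hPos hx).le
    have hyi : y ⬝ᵥ L.mulVec (Pi.single i 1) = L.det * r i := by
      rw [Matrix.dotProduct_mulVec, ← Matrix.mulVec_transpose, hSym.eq, hLy]
      simp
    have h := hnn (r i • Pi.single i 1 - L i i • y)
    have hCS := hnn ((L.det * r i) • Pi.single i 1 - L i i • y)
    simp only [Matrix.mulVec_sub, Matrix.mulVec_smul, dotProduct_sub, sub_dotProduct,
      smul_dotProduct, dotProduct_smul, hyi, hLy, smul_eq_mul, single_one_dotProduct,
      dotProduct_comm y r] at hCS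
    have hii : L.mulVec (Pi.single i 1) i = L i i := by simp
    rw [hii] at hCS
    have hmul : 0 ≤ (L i i * L.det) * (L i i * (r ⬝ᵥ y) - L.det * r i ^ 2) := by
      linarith
    have h1 := nonneg_of_mul_nonneg_right hmul (mul_pos hLi hdet)
    have h2 : r i ^ 2 ≤ L.det * r i ^ 2 :=
      le_mul_of_one_le_left (sq_nonneg _) (by omega)
    have h3 := mul_le_mul_of_nonneg_left hr hLi.le
    linarith
  refine ⟨fun i => ?_, fun i => ?_⟩
  · have := hbound i
    change -(L i i * C) ≤ r i
    nlinarith [Int.le_self_sq (r i), Int.le_self_sq (-(r i))]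
  · exact (Int.le_self_sq _).trans (hbound i)

/-- Let `L` be a positive definite Jacobi index of rank `N` and
`s̃ ∈ Mat_N(ℤ)`, `det s̃ ≠ 0`, with `L = s̃ᵀL's̃` for some even symmetric `L'`.  Then there
is a finite set `S` of nonzero vectors of `ℤ^N`, depending only on `L` and `s̃`, such that
for every weight `k` and every formal Jacobi Fourier coefficient system `c` of weight `k`
and index `L`: if for all `s ∈ S`, all `n`, and all integers `r̃` not divisible by
`l_s := gcd` of the entries of `s̃·s`, the (finitely supported) sum
`Σ_{sᵀr = r̃} c(n, r)` vanishes, then `c(n, r) = 0` whenever `r ∉ s̃ᵀℤ^N`. -/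
theorem oldforms_by_restriction (N : ℕ) (hN : 1 ≤ N)
    (L : Matrix (Fin N) (Fin N) ℤ)
    (hSym : L.IsSymm) (hEven : ∀ i, Even (L i i))
    (hPos : (L.map (Int.cast : ℤ → ℝ)).PosDef)
    (st : Matrix (Fin N) (Fin N) ℤ) (hst : st.det ≠ 0)
    (hsub : ∃ L' : Matrix (Fin N) (Fin N) ℤ,
      L'.IsSymm ∧ (∀ i, Even (L' i i)) ∧ L = stᵀ * L' * st) :
    ∃ S : Finset (Fin N → ℤ), (∀ s ∈ S, s ≠ 0) ∧
      ∀ (k : ℤ) (c : ℤ × (Fin N → ℤ) → ℂ),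
        -- (i) elliptic transformation law for the coefficients
        (∀ (n : ℤ) (r lam : Fin N → ℤ) (m : ℤ), 2 * m = lam ⬝ᵥ L.mulVec lam →
          c (n, r) = c (n + m + r ⬝ᵥ lam, r + L.mulVec lam)) →
        -- (ii) behaviour under `r ↦ −r`
        (∀ (n : ℤ) (r : Fin N → ℤ), c (n, -r) = (-1 : ℂ) ^ k * c (n, r)) →
        -- (iii) vanishing of coefficients of negative discriminant
        (∀ (n : ℤ) (r : Fin N → ℤ),
          2 * L.det * n - r ⬝ᵥ L.adjugate.mulVec r < 0 → c (n, r) = 0) →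
        -- hypothesis: restrictions are old
        (∀ s ∈ S, ∀ (n : ℤ) (rt : ℤ),
          ¬ (Finset.univ.gcd fun i => st.mulVec s i) ∣ rt →
          (∑ᶠ (r : Fin N → ℤ) (_ : s ⬝ᵥ r = rt), c (n, r)) = 0) →
        -- conclusion
        ∀ (n : ℤ) (r : Fin N → ℤ), (¬ ∃ y : Fin N → ℤ, r = stᵀ.mulVec y) →
          c (n, r) = 0 := by
  classical
  obtain ⟨L', -, -, hL'⟩ := hsub
  have hdet : 0 < L.det := by
    have h := hPos.det_pos
    have e : (L.map (Int.cast : ℤ → ℝ)).det = (L.det : ℝ) :=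
      ((Int.castRingHom ℝ).map_det L).symm
    rw [e] at h
    exact_mod_cast h
  have hbox : (Set.Icc (0 : Fin N → ℤ) fun _ => L.det).Finite := Set.finite_Icc _ _
  have hsep : ∀ r₀ : Fin N → ℤ, ∃ s : Fin N → ℤ, (¬ ∃ y : Fin N → ℤ, r₀ = stᵀ.mulVec y) →
      (¬ (Finset.univ.gcd fun i => st.mulVec s i) ∣ s ⬝ᵥ r₀) ∧
      ∀ r, r ⬝ᵥ L.adjugate.mulVec r ≤ r₀ ⬝ᵥ L.adjugate.mulVec r₀ → r ≠ r₀ →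
        s ⬝ᵥ r ≠ s ⬝ᵥ r₀ := by
    intro r₀
    by_cases hr₀ : ∃ y : Fin N → ℤ, r₀ = stᵀ.mulVec y
    · exact ⟨0, fun h => absurd hr₀ h⟩
    · obtain ⟨s, hs, hs'⟩ := exists_separating_vector hst hr₀
        (finite_setOf_dotProduct_adjugate_mulVec_le hSym hPos hdet
          (r₀ ⬝ᵥ L.adjugate.mulVec r₀)).toFinset
      exact ⟨s, fun _ => ⟨hs, fun r hr => hs' r (by simpa using hr)⟩⟩
  choose σ hσ using hsep
  refine ⟨(hbox.toFinset.image σ).erase 0, fun s hs => Finset.ne_of_mem_erase hs, ?_⟩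
  intro k c htrans _ hneg hold
  have hadjSym : L.adjugateᵀ = L.adjugate := by rw [Matrix.adjugate_transpose, hSym.eq]
  have key : ∀ (D : ℕ) (n : ℤ) (r : Fin N → ℤ), (¬ ∃ y : Fin N → ℤ, r = stᵀ.mulVec y) →
      2 * L.det * n - r ⬝ᵥ L.adjugate.mulVec r < D → c (n, r) = 0 := by
    intro D
    induction D with
    | zero => exact fun n r _ h => hneg n r (by simpa using h)
    | succ D ih =>
      intro n r hr hD
      set lam : Fin N → ℤ := L.adjugate.mulVec fun i => -(r i / L.det) with hlam
      have hLlam : L.mulVec lam = L.det • fun i => -(r i / L.det) := by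
        rw [hlam, Matrix.mulVec_mulVec, Matrix.mul_adjugate, Matrix.smul_mulVec,
          Matrix.one_mulVec]
      obtain ⟨m, hm⟩ := exists_two_mul_eq_dotProduct_mulVec hSym hEven lam
      rw [htrans n r lam m hm]
      set r₀ := r + L.mulVec lam with hr₀def
      have hr₀box : r₀ ∈ hbox.toFinset := by
        rw [Set.Finite.mem_toFinset]
        have hval : ∀ i, r₀ i = r i % L.det := by
          intro i
          rw [hr₀def, hLlam, Int.emod_def]
          simp
          ring
        refine ⟨fun i => ?_, fun i => ?_⟩
        · rw [hval]; exact Int.emod_nonneg _ hdet.ne'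
        · rw [hval]; exact (Int.emod_lt_of_pos _ hdet).le
      have hr₀ : ¬ ∃ y : Fin N → ℤ, r₀ = stᵀ.mulVec y := by
        rintro ⟨y, hy⟩
        refine hr ⟨y - L'.mulVec (st.mulVec lam), ?_⟩
        rw [Matrix.mulVec_sub, ← hy, Matrix.mulVec_mulVec, Matrix.mulVec_mulVec,
          ← hL', hr₀def, add_sub_cancel_right]
      have hadj : L.adjugate.mulVec (L.mulVec lam) = L.det • lam := by
        rw [Matrix.mulVec_mulVec, Matrix.adjugate_mul, Matrix.smul_mulVec, Matrix.one_mulVec]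
      have hcross : L.mulVec lam ⬝ᵥ L.adjugate.mulVec r = L.det * (r ⬝ᵥ lam) := by
        rw [Matrix.dotProduct_mulVec, ← Matrix.mulVec_transpose, hadjSym, hadj,
          smul_dotProduct, dotProduct_comm, smul_eq_mul]
      have hdisc : 2 * L.det * (n + m + r ⬝ᵥ lam) - r₀ ⬝ᵥ L.adjugate.mulVec r₀ =
          2 * L.det * n - r ⬝ᵥ L.adjugate.mulVec r := by
        rw [hr₀def, Matrix.mulVec_add, hadj, add_dotProduct, dotProduct_add, dotProduct_add,
          hcross, dotProduct_smul, dotProduct_smul, dotProduct_comm (L.mulVec lam) lam, ← hm,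
          smul_eq_mul, smul_eq_mul]
        ring
      obtain ⟨hgcd, hsep⟩ := hσ r₀ hr₀
      have hσ0 : σ r₀ ≠ 0 := by
        intro h
        rw [h, zero_dotProduct] at hgcd
        exact hgcd (dvd_zero _)
      have hsum := hold (σ r₀)
        (Finset.mem_erase.2 ⟨hσ0, Finset.mem_image_of_mem σ hr₀box⟩)
        (n + m + r ⬝ᵥ lam) (σ r₀ ⬝ᵥ r₀) hgcd
      rw [finsum_eq_single _ r₀] at hsum
      · simpa using hsum
      intro x hx
      by_cases hxs : σ r₀ ⬝ᵥ x = σ r₀ ⬝ᵥ r₀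
      · simp only [hxs, finsum_true]
        refine ih _ _ ?_ ?_
        · rintro ⟨y, rfl⟩
          apply hgcd
          rw [← hxs, Matrix.dotProduct_mulVec, Matrix.vecMul_transpose]
          exact Finset.dvd_sum fun i _ =>
            (Finset.gcd_dvd (Finset.mem_univ i)).mul_right _
        · have hlt := not_le.1 fun h => hsep x h hx hxs
          push_cast at hD
          linarith
      · simp [hxs]
  intro n r hr
  exact key (2 * L.det * n - r ⬝ᵥ L.adjugate.mulVec r + 1).toNat n r hr (by omega)
end

section
/- Let N ≥ 1 and let s̃ ∈ Mat_N(ℤ) with det s̃ ≠ 0. There exists a finite set S of nonzero vectors in ℤ^N, depending only on s̃, with the following property. For s ∈ S let l_s denote the greatest common divisor of the entries of s̃·s. If L ∈ Mat_N(ℤ) is symmetric with even diagonal entries and for every s ∈ S the integer sᵀLs is divisible by 2·l_s², then there exists a symmetric matrix L' ∈ Mat_N(ℤ) with even diagonal entries such that L = s̃ᵀ·L'·s̃. -/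
open Matrix

/-- The quadratic form of `Bᵀ * L * B` at `v` is that of `L` at `B *ᵥ v`. -/
theorem mulVec_dotProduct_mulVec_mulVec {n R : Type*} [Fintype n] [CommRing R]
    (B L : Matrix n n R) (v : n → R) :
    (B *ᵥ v) ⬝ᵥ L *ᵥ (B *ᵥ v) = v ⬝ᵥ (Bᵀ * L * B) *ᵥ v := by
  rw [← mulVec_mulVec, ← mulVec_mulVec, dotProduct_mulVec v, vecMul_transpose]

theorem det_dvd_gcd_mulVec_adjugate {n : Type*} [Fintype n] [DecidableEq n]
    (A : Matrix n n ℤ) (v : n → ℤ) :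
    A.det ∣ Finset.univ.gcd fun i => (A *ᵥ (A.adjugate *ᵥ v)) i := by
  refine Finset.dvd_gcd fun i _ => ?_
  simp [mulVec_mulVec, mul_adjugate]

theorem adjugate_mulVec_ne_zero {n : Type*} [Fintype n] [DecidableEq n]
    {A : Matrix n n ℤ} (hA : A.det ≠ 0) {v : n → ℤ} (hv : v ≠ 0) :
    A.adjugate *ᵥ v ≠ 0 := by
  intro h
  have h' : A.det • v = 0 := by
    simpa [mulVec_mulVec, mul_adjugate, smul_mulVec] using congrArg (A *ᵥ ·) h
  exact (smul_eq_zero.mp h').elim hA hv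

/-- A symmetric integral matrix whose quadratic form is divisible by `2 * c` at all
`eᵢ` and `eᵢ + eⱼ` is `c` times a symmetric matrix with even diagonal. -/
theorem exists_even_eq_smul {n : Type*} [Fintype n] [DecidableEq n]
    {Q : Matrix n n ℤ} (hQ : Q.IsSymm) {c : ℤ} (hc : c ≠ 0)
    (h₁ : ∀ i, 2 * c ∣ Pi.single i 1 ⬝ᵥ Q *ᵥ Pi.single i 1)
    (h₂ : ∀ i j, 2 * c ∣
      (Pi.single i 1 + Pi.single j 1) ⬝ᵥ Q *ᵥ (Pi.single i 1 + Pi.single j 1)) :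
    ∃ P : Matrix n n ℤ, P.IsSymm ∧ (∀ i, Even (P i i)) ∧ Q = c • P := by
  have hdiag : ∀ i, 2 * c ∣ Q i i := fun i => by simpa using h₁ i
  have hdvd : ∀ i j, c ∣ Q i j := fun i j => by
    have h := h₂ i j
    simp only [mulVec_add, add_dotProduct, dotProduct_add, mulVec_single_one,
      single_one_dotProduct, col_apply] at h
    rw [hQ.apply i j] at h
    obtain ⟨a, ha⟩ := hdiag i
    obtain ⟨b, hb⟩ := hdiag j
    obtain ⟨k, hk⟩ := h
    exact ⟨k - a - b, by linarith⟩
  choose P hP using hdvd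
  refine ⟨of P, ?_, fun i => ?_, ?_⟩
  · ext i j
    refine mul_left_cancel₀ hc ?_
    simpa [← hP] using hQ.apply i j
  · obtain ⟨a, ha⟩ := hdiag i
    refine even_iff_two_dvd.mpr ⟨a, mul_left_cancel₀ hc ?_⟩
    rw [of_apply, ← hP, ha]
    ring
  · ext i j
    simp [hP i j]

theorem eq_transpose_mul_mul_of_adjugate {n : Type*} [Fintype n] [DecidableEq n]
    {A L P : Matrix n n ℤ} (hA : A.det ≠ 0)
    (h : A.adjugateᵀ * L * A.adjugate = A.det ^ 2 • P) : L = Aᵀ * P * A := by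
  have h' : A.det ^ 2 • L = A.det ^ 2 • (Aᵀ * P * A) :=
    calc A.det ^ 2 • L = (A.adjugate * A)ᵀ * L * (A.adjugate * A) := by
          rw [adjugate_mul, transpose_smul, transpose_one, Matrix.smul_mul, Matrix.one_mul,
            Matrix.smul_mul, Matrix.mul_smul, Matrix.mul_one, smul_smul, pow_two]
      _ = Aᵀ * (A.adjugateᵀ * L * A.adjugate) * A := by
          simp only [transpose_mul, Matrix.mul_assoc]
      _ = A.det ^ 2 • (Aᵀ * P * A) := by
          rw [h, Matrix.mul_smul, Matrix.smul_mul]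
  ext i j
  exact mul_left_cancel₀ (pow_ne_zero 2 hA) (congrFun (congrFun h' i) j)

/-- Let `s̃ ∈ Mat_N(ℤ)` with `det s̃ ≠ 0`. There is a finite set `S` of
nonzero vectors in `ℤ^N`, depending only on `s̃`, such that: if `L` is symmetric with even
diagonal and for every `s ∈ S` the integer `sᵀLs` is divisible by `2·l_s²`, where `l_s` is
the gcd of the entries of `s̃·s`, then `L = s̃ᵀ·L'·s̃` for some symmetric `L' ∈ Mat_N(ℤ)`
with even diagonal. -/
theorem sublattice_by_restriction (N : ℕ) (hN : 1 ≤ N)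
    (st : Matrix (Fin N) (Fin N) ℤ) (hst : st.det ≠ 0) :
    ∃ S : Finset (Fin N → ℤ), (∀ s ∈ S, s ≠ 0) ∧
      ∀ L : Matrix (Fin N) (Fin N) ℤ, L.IsSymm → (∀ i, Even (L i i)) →
        (∀ s ∈ S, (2 * (Finset.univ.gcd fun i => st.mulVec s i) ^ 2) ∣ s ⬝ᵥ L.mulVec s) →
        ∃ L' : Matrix (Fin N) (Fin N) ℤ,
          L'.IsSymm ∧ (∀ i, Even (L' i i)) ∧ L = stᵀ * L' * st := by
  classical
  refine ⟨(Finset.univ.image fun i => st.adjugate *ᵥ Pi.single i 1) ∪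
    Finset.univ.image fun p : Fin N × Fin N =>
      st.adjugate *ᵥ (Pi.single p.1 1 + Pi.single p.2 1), ?_, fun L hL _ hS => ?_⟩
  · simp only [Finset.mem_union, Finset.mem_image, Finset.mem_univ, true_and]
    rintro _ (⟨i, rfl⟩ | ⟨⟨i, j⟩, rfl⟩)
    · exact adjugate_mulVec_ne_zero hst (by simp)
    · refine adjugate_mulVec_ne_zero hst fun h => ?_
      have hi := congrFun h i
      by_cases hij : i = j <;> simp [hij] at hi
  · have key : ∀ v : Fin N → ℤ,
        (2 * (Finset.univ.gcd fun i => (st *ᵥ (st.adjugate *ᵥ v)) i) ^ 2 ∣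
          (st.adjugate *ᵥ v) ⬝ᵥ L *ᵥ (st.adjugate *ᵥ v)) →
        2 * st.det ^ 2 ∣ v ⬝ᵥ (st.adjugateᵀ * L * st.adjugate) *ᵥ v := fun v h => by
      rw [← mulVec_dotProduct_mulVec_mulVec]
      exact (mul_dvd_mul_left 2 (pow_dvd_pow_of_dvd (det_dvd_gcd_mulVec_adjugate st v) 2)).trans h
    have hQ : (st.adjugateᵀ * L * st.adjugate).IsSymm := by
      simp [IsSymm, transpose_mul, hL.eq, Matrix.mul_assoc]
    obtain ⟨P, hPsymm, hPeven, hP⟩ := exists_even_eq_smul hQ (pow_ne_zero 2 hst)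
      (fun i => key _ (hS _ (by simp)))
      (fun i j => key _ (hS _ (Finset.mem_union_right _
        (Finset.mem_image_of_mem _ (Finset.mem_univ (i, j))))))
    exact ⟨P, hPsymm, hPeven, eq_transpose_mul_mul_of_adjugate hst hP⟩
end
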